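/- arXiv:2404.00337 — 11 statements merged into one kernel-verified Lean document; each statement's English description precedes it below -/
import Mathlib

section
/- Let (M,d) be a compact metric space, g : M → M a bijection, and U₀, U₁ ⊆ M disjoint sets. Let v : ℕ → {0,1}, and let (α_k)_{k≥1}, (β_k)_{k≥1} be sequences of natural numbers with α strictly increasing and α_k + β_k + 1 ≤ α_{k+1} for all k, whose intervals I_k = [α_k, α_k + β_k] ∩ ℕ satisfy (DEI). Assume: (i) D ⊆ M is nonempty and g^n(D) ⊆ U_{v_n} for every n ∈ ⋃_k I_k; (ii) x ∈ M satisfies g^n(x) ∈ U_{v_n} for every n ≥ 0; (iii) for every ε > 0 there is N ∈ ℕ such that for every w : {−N,…,N} → {0,1} the set ⋂_{k=−N}^{N} g^{−k}(U_{w_k}) has diameter at most ε. Then lim_{n→∞} (1/n) Σ_{j=0}^{n−1} sup_{y∈D} d(g^j(y), g^j(x)) = 0. -/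
open Filter
open scoped Classical

/-- The pair of sequences `(α, β)` satisfies condition (DEI): the integer intervals
`I k = [α k, α k + β k]` have asymptotic density `1`. -/
def DEI (α β : ℕ → ℕ) : Prop :=
  Tendsto
    (fun N : ℕ =>
      (((Finset.range N).filter fun n =>
          ∃ k, n ∈ Finset.Icc (α k) (α k + β k)).card : ℝ) / N)
    atTop (nhds 1)

/-- Shifting the window of summation of a `[0, 1]`-valued sequence by `i` increases a partial sum
by at most `i`. -/
theorem sum_range_shift_le (b : ℕ → ℝ) (h0 : ∀ j, 0 ≤ b j) (h1 : ∀ j, b j ≤ 1) (n i : ℕ) :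
    ∑ j ∈ Finset.range n, b (j + i) ≤ i + ∑ j ∈ Finset.range n, b j := by
  have h : ∑ j ∈ Finset.range n, b (j + i) ≤ ∑ j ∈ Finset.range (n + i), b j := by
    rw [add_comm n i, Finset.sum_range_add]
    simp only [add_comm]
    exact le_add_of_nonneg_left (Finset.sum_nonneg fun j _ => h0 j)
  have h' : ∑ j ∈ Finset.range i, b (n + j) ≤ i := by
    simpa using Finset.sum_le_sum (s := Finset.range i) fun j _ => h1 (n + j)
  rw [Finset.sum_range_add] at h
  linarith

/-- If a bounded nonnegative sequence `a` is small wherever a window of `b` vanishes, and `b`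
has vanishing averages, then `a` has vanishing averages. -/
theorem tendsto_average_zero_of_le_window (a b : ℕ → ℝ) (C : ℝ)
    (ha0 : ∀ j, 0 ≤ a j) (haC : ∀ j, a j ≤ C) (hb0 : ∀ j, 0 ≤ b j) (hb1 : ∀ j, b j ≤ 1)
    (hb : Tendsto (fun n : ℕ => (∑ j ∈ Finset.range n, b j) / n) atTop (nhds 0))
    (hab : ∀ ε : ℝ, 0 < ε → ∃ N : ℕ, ∀ j,
      a (j + N) ≤ ε + C * ∑ i ∈ Finset.range (2 * N + 1), b (j + i)) :
    Tendsto (fun n : ℕ => (1 / (n : ℝ)) * ∑ j ∈ Finset.range n, a j) atTop (nhds 0) := by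
  have hC : 0 ≤ C := (ha0 0).trans (haC 0)
  have key : ∀ ε : ℝ, 0 < ε → ∃ K L : ℝ, ∀ n : ℕ,
      ∑ j ∈ Finset.range n, a j ≤ n * ε + K + L * ∑ j ∈ Finset.range n, b j := by
    intro ε hε
    obtain ⟨N, hN⟩ := hab ε hε
    refine ⟨N * C + C * ∑ i ∈ Finset.range (2 * N + 1), (i : ℝ), C * (2 * N + 1), fun n => ?_⟩
    have e1 : ∑ j ∈ Finset.range n, a j ≤ N * C + ∑ j ∈ Finset.range n, a (j + N) := by
      have h : ∑ j ∈ Finset.range n, a j ≤ ∑ j ∈ Finset.range (N + n), a j :=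
        Finset.sum_le_sum_of_subset_of_nonneg (by simp) fun j _ _ => ha0 j
      have h' : ∑ j ∈ Finset.range N, a j ≤ N * C := by
        simpa using Finset.sum_le_sum (s := Finset.range N) fun j _ => haC j
      rw [Finset.sum_range_add] at h
      simp only [add_comm N] at h
      linarith
    have e2 : ∑ j ∈ Finset.range n, a (j + N) ≤
        n * ε + C * ∑ i ∈ Finset.range (2 * N + 1), ∑ j ∈ Finset.range n, b (j + i) := by
      refine (Finset.sum_le_sum fun j _ => hN j).trans_eq ?_
      rw [Finset.sum_add_distrib, ← Finset.mul_sum, Finset.sum_comm]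
      simp
    have e3 : ∑ i ∈ Finset.range (2 * N + 1), ∑ j ∈ Finset.range n, b (j + i) ≤
        ∑ i ∈ Finset.range (2 * N + 1), (i : ℝ) + (2 * N + 1) * ∑ j ∈ Finset.range n, b j := by
      refine (Finset.sum_le_sum fun i _ => sum_range_shift_le b hb0 hb1 n i).trans_eq ?_
      rw [Finset.sum_add_distrib]
      simp
    have e4 := mul_le_mul_of_nonneg_left e3 hC
    linarith
  refine tendsto_order.2 ⟨fun c hc => Eventually.of_forall fun n => hc.trans_le ?_, fun c hc => ?_⟩
  · exact mul_nonneg (by positivity) (Finset.sum_nonneg fun j _ => ha0 j)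
  · obtain ⟨K, L, hKL⟩ := key (c / 2) (by positivity)
    have hlim : Tendsto (fun n : ℕ => c / 2 + K / n + L * ((∑ j ∈ Finset.range n, b j) / n))
        atTop (nhds (c / 2)) := by
      simpa using (tendsto_const_nhds.add (tendsto_const_div_atTop_nhds_zero_nat K)).add
        (hb.const_mul L)
    filter_upwards [hlim.eventually_lt_const (half_lt_self hc), eventually_gt_atTop 0] with n hn hn0
    refine lt_of_le_of_lt ?_ hn
    have hn' : (0 : ℝ) < n := by exact_mod_cast hn0
    calc (1 / (n : ℝ)) * ∑ j ∈ Finset.range n, a j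
        ≤ (1 / (n : ℝ)) * (n * (c / 2) + K + L * ∑ j ∈ Finset.range n, b j) :=
          mul_le_mul_of_nonneg_left (hKL n) (by positivity)
      _ = _ := by field_simp

/-- The complement of a set of asymptotic density `1` has density `0`. -/
theorem tendsto_average_compl_zero (p : ℕ → Prop)
    (hp : Tendsto (fun N : ℕ => (((Finset.range N).filter p).card : ℝ) / N) atTop (nhds 1)) :
    Tendsto (fun n : ℕ => (∑ j ∈ Finset.range n, if p j then (0 : ℝ) else 1) / n)
      atTop (nhds 0) := by
  have h := hp.const_sub 1
  rw [sub_self] at h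
  refine h.congr' ?_
  filter_upwards [eventually_gt_atTop 0] with n hn
  have hn' : (n : ℝ) ≠ 0 := by exact_mod_cast hn.ne'
  have hs : (∑ j ∈ Finset.range n, if p j then (0 : ℝ) else 1) =
      n - ((Finset.range n).filter p).card := by
    have hsum : (∑ j ∈ Finset.range n, if p j then (0 : ℝ) else 1) =
        ∑ j ∈ Finset.range n, (1 - if p j then (1 : ℝ) else 0) :=
      Finset.sum_congr rfl fun j _ => by split_ifs <;> simp
    rw [hsum, Finset.sum_sub_distrib, Finset.sum_boole]
    simp
  rw [hs, sub_div, div_self hn']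

/-- If `g^n(D) ⊆ U (v n)` for all times `n` in a (DEI) family of
intervals, the orbit of `x` follows the coding `v`, and cylinders of the coding have
uniformly small diameter, then the time averages of the `D`-uniform distance between
orbits of points of `D` and the orbit of `x` tend to `0`. -/
theorem stmt2
    {M : Type*} [MetricSpace M] [CompactSpace M]
    (g : Equiv.Perm M) (U : Fin 2 → Set M)
    (hU : Disjoint (U 0) (U 1))
    (v : ℕ → Fin 2) (α β : ℕ → ℕ)
    (hα : StrictMono α)
    (hsep : ∀ k, α k + β k + 1 ≤ α (k + 1))
    (hDEI : DEI α β)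
    (D : Set M) (hD : D.Nonempty)
    (hOCD : ∀ n : ℕ, (∃ k, n ∈ Finset.Icc (α k) (α k + β k)) →
      ⇑(g ^ (n : ℤ)) '' D ⊆ U (v n))
    (x : M) (hx : ∀ n : ℕ, (g ^ (n : ℤ)) x ∈ U (v n))
    (hdiam : ∀ ε : ℝ, 0 < ε → ∃ N : ℕ, ∀ w : ℤ → Fin 2,
      Metric.diam {p : M | ∀ k : ℤ, |k| ≤ (N : ℤ) → (g ^ k) p ∈ U (w k)} ≤ ε) :
    Tendsto
      (fun n : ℕ => (1 / (n : ℝ)) *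
        ∑ j ∈ Finset.range n, ⨆ y ∈ D, dist ((g ^ (j : ℤ)) y) ((g ^ (j : ℤ)) x))
      atTop (nhds 0) := by
  have hdist : ∀ p q : M, dist p q ≤ Metric.diam (Set.univ : Set M) := fun p q =>
    Metric.dist_le_diam_of_mem isCompact_univ.isBounded trivial trivial
  refine tendsto_average_zero_of_le_window _
    (fun n => if ∃ k, n ∈ Finset.Icc (α k) (α k + β k) then (0 : ℝ) else 1)
    (Metric.diam (Set.univ : Set M)) (fun j => ?_) (fun j => ?_) (fun j => ?_) (fun j => ?_)
    (tendsto_average_compl_zero _ hDEI) fun ε hε => ?_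
  · exact Real.iSup_nonneg fun y => Real.iSup_nonneg fun _ => dist_nonneg
  · exact Real.iSup_le (fun y => Real.iSup_le (fun _ => hdist _ _) Metric.diam_nonneg)
      Metric.diam_nonneg
  · split_ifs <;> simp
  · split_ifs <;> simp
  obtain ⟨N, hN⟩ := hdiam ε hε
  refine ⟨N, fun j => ?_⟩
  set b : ℕ → ℝ := fun n => if ∃ k, n ∈ Finset.Icc (α k) (α k + β k) then (0 : ℝ) else 1
    with hbdef
  have hb0 : ∀ n, 0 ≤ b n := fun n => by
    simp only [hbdef]
    split_ifs <;> simp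
  have hsum0 : 0 ≤ ∑ i ∈ Finset.range (2 * N + 1), b (j + i) :=
    Finset.sum_nonneg fun i _ => hb0 _
  have hrhs : 0 ≤ ε + Metric.diam (Set.univ : Set M) *
      ∑ i ∈ Finset.range (2 * N + 1), b (j + i) :=
    add_nonneg hε.le (mul_nonneg Metric.diam_nonneg hsum0)
  refine Real.iSup_le (fun y => Real.iSup_le (fun hy => ?_) hrhs) hrhs
  by_cases hall : ∀ i < 2 * N + 1, ∃ k, j + i ∈ Finset.Icc (α k) (α k + β k)
  · refine le_trans ?_ (le_add_of_nonneg_right (mul_nonneg Metric.diam_nonneg hsum0))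
    refine le_trans (Metric.dist_le_diam_of_mem
      (isCompact_univ.isBounded.subset (Set.subset_univ _)) ?_ ?_)
      (hN fun k => v (((j + N : ℕ) : ℤ) + k).toNat)
    all_goals
      intro k hk
      obtain ⟨hk1, hk2⟩ := abs_le.1 hk
      obtain ⟨i, hi, hik⟩ : ∃ i : ℕ, i < 2 * N + 1 ∧ k + ((j + N : ℕ) : ℤ) = ((j + i : ℕ) : ℤ) :=
        ⟨(k + N).toNat, by omega, by omega⟩
      rw [← Equiv.Perm.mul_apply, ← zpow_add, add_comm _ k, hik, Int.toNat_natCast]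
    · exact hOCD _ (hall i hi) (Set.mem_image_of_mem _ hy)
    · exact hx _
  · push Not at hall
    obtain ⟨i, hi, hbad⟩ := hall
    have hbi : b (j + i) = 1 := if_neg (by simpa using hbad)
    have hone : 1 ≤ ∑ i ∈ Finset.range (2 * N + 1), b (j + i) :=
      hbi ▸ Finset.single_le_sum (f := fun i => b (j + i)) (fun i _ => hb0 _)
        (Finset.mem_range.2 hi)
    have := le_mul_of_one_le_right (Metric.diam_nonneg (s := (Set.univ : Set M))) hone
    linarith [hdist ((g ^ ((j + N : ℕ) : ℤ)) y) ((g ^ ((j + N : ℕ) : ℤ)) x)]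
end

section
/- Let (M,d) be a compact metric space, g : M → M a map, U₀, U₁ ⊆ M disjoint sets, V₀ ⊆ U₀ and V₁ ⊆ U₁ subsets, and d₀ > 0 such that for each i ∈ {0,1}, every p ∈ V_i and every q ∈ M \ U_i satisfy d(p,q) ≥ d₀. Let v : ℕ → {0,1}, let x ∈ M satisfy g^n(x) ∈ V_{v_n} for every n ≥ 0, and let D ⊆ M be nonempty with lim_{n→∞} (1/n) Σ_{j=0}^{n−1} sup_{y∈D} d(g^j(y), g^j(x)) = 0. Then there exist sequences (α_k)_{k≥1}, (β_k)_{k≥1} of natural numbers, with α strictly increasing and α_k + β_k + 1 ≤ α_{k+1} for all k, whose intervals I_k = [α_k, α_k + β_k] ∩ ℕ satisfy (DEI) and such that g^n(D) ⊆ U_{v_n} for every n ∈ ⋃_k I_k. -/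
open Filter
open scoped Classical

/-- By Markov's inequality, if the averages of a nonnegative sequence tend to `0`, then the set of
indices where the sequence is below a given positive threshold has density `1`. -/
theorem tendsto_density_lt_of_tendsto_average_zero {s : ℕ → ℝ} (hs : ∀ n, 0 ≤ s n) {c : ℝ}
    (hc : 0 < c)
    (h : Tendsto (fun n : ℕ => (1 / (n : ℝ)) * ∑ j ∈ Finset.range n, s j) atTop (nhds 0)) :
    Tendsto (fun N : ℕ => (((Finset.range N).filter fun n => s n < c).card : ℝ) / N)
      atTop (nhds 1) := by
  have hlow : Tendsto (fun n : ℕ => 1 - c⁻¹ * ((1 / (n : ℝ)) * ∑ j ∈ Finset.range n, s j))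
      atTop (nhds 1) := by
    simpa using (h.const_mul c⁻¹).const_sub 1
  refine tendsto_of_tendsto_of_tendsto_of_le_of_le' hlow tendsto_const_nhds ?_ ?_
  · filter_upwards [eventually_gt_atTop 0] with N hN
    have hN' : (0 : ℝ) < N := by exact_mod_cast hN
    have hcard : (((Finset.range N).filter fun n => s n < c).card : ℝ)
        + ((Finset.range N).filter fun n => ¬ s n < c).card = N := by
      exact_mod_cast (Finset.card_filter_add_card_filter_not (s := Finset.range N)
        (fun n => s n < c)).trans (Finset.card_range N)
    have hmarkov : (((Finset.range N).filter fun n => ¬ s n < c).card : ℝ) * c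
        ≤ ∑ j ∈ Finset.range N, s j := by
      rw [← nsmul_eq_mul]
      refine (Finset.card_nsmul_le_sum _ s c fun n hn => ?_).trans
        (Finset.sum_le_sum_of_subset_of_nonneg (Finset.filter_subset _ _) fun n _ _ => hs n)
      exact not_lt.1 (Finset.mem_filter.1 hn).2
    rw [le_div_iff₀ hN']
    have heq : (1 - c⁻¹ * (1 / (N : ℝ) * ∑ j ∈ Finset.range N, s j)) * N
        = N - (∑ j ∈ Finset.range N, s j) / c := by
      field_simp
    rw [heq]
    linarith [(le_div_iff₀ hc).2 hmarkov]
  · refine Eventually.of_forall fun N => div_le_one_of_le₀ ?_ N.cast_nonneg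
    exact_mod_cast (Finset.card_filter_le _ _).trans (Finset.card_range N).le

/-- A set of natural numbers of density `1` is infinite. -/
theorem infinite_of_tendsto_density_one {p : ℕ → Prop}
    (h : Tendsto (fun N : ℕ => (((Finset.range N).filter p).card : ℝ) / N) atTop (nhds 1)) :
    {n | p n}.Infinite := by
  intro hfin
  have h0 : Tendsto (fun N : ℕ => (((Finset.range N).filter p).card : ℝ) / N) atTop (nhds 0) := by
    refine squeeze_zero (fun N => by positivity) (fun N => ?_)
      (tendsto_const_div_atTop_nhds_zero_nat (hfin.toFinset.card : ℝ))
    gcongr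
    intro n hn
    exact hfin.mem_toFinset.2 (Finset.mem_filter.1 hn).2
  exact zero_ne_one (tendsto_nhds_unique h0 h)

/-- Enumerating a set of density `1` gives one-point intervals satisfying (DEI). -/
theorem exists_dei_of_tendsto_density_one {p : ℕ → Prop}
    (h : Tendsto (fun N : ℕ => (((Finset.range N).filter p).card : ℝ) / N) atTop (nhds 1)) :
    ∃ α β : ℕ → ℕ, StrictMono α ∧ (∀ k, α k + β k + 1 ≤ α (k + 1)) ∧ DEI α β ∧
      ∀ n, (∃ k, n ∈ Finset.Icc (α k) (α k + β k)) → p n := by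
  have hinf := infinite_of_tendsto_density_one h
  have hmono := Nat.nth_strictMono hinf
  have hmem : ∀ n, (∃ k, n ∈ Finset.Icc (Nat.nth p k) (Nat.nth p k + 0)) ↔ p n := by
    intro n
    have hrange : n ∈ Set.range (Nat.nth p) ↔ p n := by rw [Nat.range_nth_of_infinite hinf]; rfl
    simp [← hrange, eq_comm]
  refine ⟨Nat.nth p, fun _ => 0, hmono, fun k => hmono k.lt_succ_self, ?_,
    fun n => (hmem n).1⟩
  unfold DEI
  simpa only [hmem] using h

/-- If the orbit of `x` follows the coding `v` inside the sets `V i`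
and the time averages of the `D`-uniform distance to the orbit of `x` tend to `0`,
then there is a (DEI) family of intervals on which `g^n(D) ⊆ U (v n)`. -/
theorem stmt3
    {M : Type*} [MetricSpace M] [CompactSpace M]
    (g : M → M) (U V : Fin 2 → Set M)
    (hUdisj : Disjoint (U 0) (U 1))
    (hUV : ∀ i, V i ⊆ U i) (d₀ : ℝ) (hd₀ : 0 < d₀)
    (hsep : ∀ i : Fin 2, ∀ p ∈ V i, ∀ q ∉ U i, d₀ ≤ dist p q)
    (v : ℕ → Fin 2) (x : M) (hx : ∀ n : ℕ, g^[n] x ∈ V (v n))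
    (D : Set M) (hD : D.Nonempty)
    (hlim : Tendsto
      (fun n : ℕ => (1 / (n : ℝ)) *
        ∑ j ∈ Finset.range n, ⨆ y ∈ D, dist (g^[j] y) (g^[j] x))
      atTop (nhds 0)) :
    ∃ α β : ℕ → ℕ,
      StrictMono α ∧
      (∀ k, α k + β k + 1 ≤ α (k + 1)) ∧
      DEI α β ∧
      ∀ n : ℕ, (∃ k, n ∈ Finset.Icc (α k) (α k + β k)) → g^[n] '' D ⊆ U (v n) := by
  have hbdd : ∀ n, BddAbove (Set.range fun y => ⨆ _ : y ∈ D, dist (g^[n] y) (g^[n] x)) := by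
    refine fun n => ⟨Metric.diam (Set.univ : Set M), ?_⟩
    rintro _ ⟨y, rfl⟩
    exact Real.iSup_le (fun _ => Metric.dist_le_diam_of_mem isCompact_univ.isBounded
      (Set.mem_univ _) (Set.mem_univ _)) Metric.diam_nonneg
  obtain ⟨α, β, hα, hαβ, hdei, hlt⟩ := exists_dei_of_tendsto_density_one
    (tendsto_density_lt_of_tendsto_average_zero
      (fun n => Real.iSup_nonneg fun y => Real.iSup_nonneg fun _ => dist_nonneg) hd₀ hlim)
  refine ⟨α, β, hα, hαβ, hdei, ?_⟩
  rintro n hn _ ⟨y, hy, rfl⟩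
  by_contra hU
  have hle : dist (g^[n] y) (g^[n] x) ≤ ⨆ y ∈ D, dist (g^[n] y) (g^[n] x) :=
    (ciSup_pos (f := fun _ : y ∈ D => dist (g^[n] y) (g^[n] x)) hy).ge.trans
      (le_ciSup (hbdd n) y)
  have hge := hsep (v n) _ (hx n) _ hU
  rw [dist_comm] at hge
  exact (hge.trans hle).not_gt (hlt n hn)
end

section
/- Let (M,d) be a compact metric space, g : M → M a homeomorphism, and V₀, V₁ ⊆ M nonempty disjoint compact sets with dist(V₀, V₁) > 0. Let Λ ⊆ V₀ ∪ V₁ satisfy g(Λ) = Λ, and suppose that the coding map I : Λ → {0,1}^ℤ, defined by I(p)_j = i whenever g^j(p) ∈ V_i, is well defined and is a bijection onto {0,1}^ℤ whose inverse is continuous with respect to the product topology on {0,1}^ℤ. Let x ∈ Λ and let D ⊆ M be an open set such that for every y ∈ D and every function φ : M → ℝ with |φ(p)| ≤ 1 for all p and Lipschitz constant at most 1, one has lim_{n→∞} (1/n) | Σ_{j=0}^{n−1} ( φ(g^j(y)) − φ(g^j(x)) ) | = 0. Then D ∩ Λ = ∅. -/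
open Filter

/-- Two sets at distance at least `δ > 0` are separated by a `1`-Lipschitz function which is bounded
by `1`, vanishes on the first set and is a positive constant on the second one. -/
theorem exists_lipschitz_separating {M : Type*} [PseudoMetricSpace M] {A B : Set M}
    (hA : A.Nonempty) {δ : ℝ} (hδ : 0 < δ) (hAB : ∀ p ∈ A, ∀ q ∈ B, δ ≤ dist p q) :
    ∃ (φ : M → ℝ) (ε : ℝ), 0 < ε ∧ (∀ p, |φ p| ≤ 1) ∧ LipschitzWith 1 φ ∧
      (∀ p ∈ A, φ p = 0) ∧ ∀ p ∈ B, φ p = ε := by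
  have hε : 0 < min 1 δ := lt_min one_pos hδ
  refine ⟨fun p => min (min 1 δ) (Metric.infDist p A), min 1 δ, hε, fun p => ?_,
    (Metric.lipschitz_infDist_pt A).const_min _, fun p hp => ?_, fun p hp => ?_⟩
  · rw [abs_of_nonneg (le_min hε.le Metric.infDist_nonneg)]
    exact (min_le_left _ _).trans (min_le_left _ _)
  · simp only [Metric.infDist_zero_of_mem hp, min_eq_right hε.le]
  · refine min_eq_left ((min_le_right _ _).trans ?_)
    exact (Metric.le_infDist hA).2 fun q hq => dist_comm p q ▸ hAB q hq p hp

/-- If two real sequences converge and the averages of each are asymptotic to those of a third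
sequence, then they have the same limit. -/
theorem eq_of_tendsto_of_tendsto_abs_average_sub {u v w : ℕ → ℝ} {a b : ℝ}
    (hu : Tendsto u atTop (nhds a)) (hv : Tendsto v atTop (nhds b))
    (huw : Tendsto (fun n : ℕ => (1 / (n : ℝ)) * |∑ j ∈ Finset.range n, (u j - w j)|)
      atTop (nhds 0))
    (hvw : Tendsto (fun n : ℕ => (1 / (n : ℝ)) * |∑ j ∈ Finset.range n, (v j - w j)|)
      atTop (nhds 0)) : a = b := by
  have key : ∀ {s : ℕ → ℝ} {c : ℝ}, Tendsto s atTop (nhds c) →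
      Tendsto (fun n : ℕ => (1 / (n : ℝ)) * |∑ j ∈ Finset.range n, (s j - w j)|)
        atTop (nhds 0) →
      Tendsto (fun n : ℕ => (n : ℝ)⁻¹ * ∑ j ∈ Finset.range n, w j) atTop (nhds c) := by
    intro s c hs hsw
    have habs : Tendsto (fun n : ℕ => (n : ℝ)⁻¹ * ∑ j ∈ Finset.range n, (s j - w j))
        atTop (nhds 0) := by
      refine (tendsto_zero_iff_abs_tendsto_zero _).2 (hsw.congr fun n => ?_)
      simp [abs_mul]
    have h := hs.cesaro.sub habs
    rw [sub_zero] at h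
    refine h.congr fun n => ?_
    rw [Finset.sum_sub_distrib]
    ring
  exact tendsto_nhds_unique (key hu huw) (key hv hvw)

/-- Replacing the terms of index greater than `N` of a two-sided sequence by a constant gives
sequences converging to the original one as `N` grows. -/
theorem tendsto_ite_le_const {α : Type*} [TopologicalSpace α] (c : ℤ → α) (a : α) :
    Tendsto (fun (N : ℕ) (j : ℤ) => if j ≤ N then c j else a) atTop (nhds c) := by
  refine tendsto_pi_nhds.2 fun j => tendsto_const_nhds.congr' ?_
  filter_upwards [eventually_ge_atTop j.toNat] with N hN
  rw [if_pos (by omega)]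

/-- **Proposition `p_D_open`.** If the coding map of the hyperbolic set `Λ`
is a bijection onto the full shift space `{0,1}^ℤ` with continuous inverse, `x ∈ Λ`, and
`D` is an open set all of whose points have empirical Birkhoff averages asymptotic to
those of `x` (in the Wasserstein sense, tested against `1`-Lipschitz functions bounded
by `1`), then `D` is disjoint from `Λ`. -/
theorem stmt4
    {M : Type*} [MetricSpace M] [CompactSpace M]
    (g : M ≃ₜ M) (V : Fin 2 → Set M)
    (hVne : ∀ i, (V i).Nonempty) (hVcpt : ∀ i, IsCompact (V i))
    (hVdisj : Disjoint (V 0) (V 1))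
    (hdist : ∃ δ : ℝ, 0 < δ ∧ ∀ p ∈ V 0, ∀ q ∈ V 1, δ ≤ dist p q)
    (Λ : Set M) (hΛ : Λ ⊆ V 0 ∪ V 1) (hginv : ⇑g '' Λ = Λ)
    (I : Λ → ℤ → Fin 2)
    (hI : ∀ (p : Λ) (j : ℤ), (g.toEquiv ^ j) (p : M) ∈ V (I p j))
    (hIbij : Function.Bijective I)
    (hIcont : Continuous (Equiv.ofBijective I hIbij).symm)
    (x : M) (hxΛ : x ∈ Λ) (D : Set M) (hDopen : IsOpen D)
    (hbirk : ∀ y ∈ D, ∀ φ : M → ℝ, (∀ p, |φ p| ≤ 1) → LipschitzWith 1 φ →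
      Tendsto
        (fun n : ℕ => (1 / (n : ℝ)) *
          |∑ j ∈ Finset.range n,
            (φ ((g.toEquiv ^ (j : ℤ)) y) - φ ((g.toEquiv ^ (j : ℤ)) x))|)
        atTop (nhds 0)) :
    D ∩ Λ = ∅ := by
  obtain ⟨δ, hδ, hsep⟩ := hdist
  obtain ⟨φ, ε, hε, hφ1, hφL, hφ0, hφε⟩ := exists_lipschitz_separating (hVne 0) hδ hsep
  refine Set.eq_empty_iff_forall_notMem.2 fun p ⟨hpD, hpΛ⟩ => ?_
  set e := Equiv.ofBijective I hIbij
  have hmem : ∀ a : Fin 2, ∃ y ∈ D, ∀ᶠ j : ℕ in atTop, (g.toEquiv ^ (j : ℤ)) y ∈ V a := by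
    intro a
    have hlim := ((continuous_subtype_val.comp hIcont).tendsto (e ⟨p, hpΛ⟩)).comp
      (tendsto_ite_le_const (e ⟨p, hpΛ⟩) a)
    have hD : D ∈ nhds ((Subtype.val ∘ e.symm) (e ⟨p, hpΛ⟩)) := by
      simpa using hDopen.mem_nhds hpD
    obtain ⟨N, hN⟩ := (hlim.eventually_mem hD).exists
    refine ⟨_, hN, ?_⟩
    filter_upwards [eventually_gt_atTop N] with j hj
    have hcode := hI (e.symm fun j : ℤ => if j ≤ N then e ⟨p, hpΛ⟩ j else a) j
    have happ : I (e.symm fun j : ℤ => if j ≤ N then e ⟨p, hpΛ⟩ j else a) = _ :=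
      e.apply_symm_apply _
    have hjN : ¬(j : ℤ) ≤ N := by omega
    simp only [happ, if_neg hjN] at hcode
    exact hcode
  obtain ⟨y, hyD, hy⟩ := hmem 0
  obtain ⟨z, hzD, hz⟩ := hmem 1
  refine hε.ne (eq_of_tendsto_of_tendsto_abs_average_sub
    (tendsto_const_nhds.congr' (hy.mono fun j hj => (hφ0 _ hj).symm))
    (tendsto_const_nhds.congr' (hz.mono fun j hj => (hφε _ hj).symm))
    (hbirk y hyD φ hφ1 hφL) (hbirk z hzD φ hφ1 hφL))
end

section
/- Let λ_cs0, λ_cs1, ε₀ be real numbers with 0 < λ_cs0 < 1/2 < λ_cs1 < 1 < λ_cs0 + λ_cs1, ε₀ > 0 and λ_cs1·(1+ε₀) < 1. Then there exist μ₀ ∈ ℕ and ε* > 0 such that for every z ∈ [−ε₀, 1+ε₀] there is a finite sequence (ι_1,…,ι_m) ∈ {0,1}^m with m ≤ μ₀ such that for every ε ∈ (0, ε*], if z ∈ [−ε₀, 1−λ_cs1+7ε] ∪ [λ_cs0−7ε, 1+ε₀] then (ζ_{ι_1} ∘ ⋯ ∘ ζ_{ι_m})(z) ∈ [1−λ_cs1+7ε,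 λ_cs0−7ε]. -/
/-- If the images of `[0, 1]` under `z ↦ a * z` and `z ↦ b * z + 1 - b` cover `[0, 1]`, then every
`y ∈ [0, 1]` is approximated by the image of a single word of length `n`, within `b ^ n * (1 + r)`
uniformly over the starting points in `[-r, 1 + r]`. -/
theorem exists_word_abs_foldr_sub_le {a b r : ℝ} (ha : 0 < a) (hab : a ≤ b) (hcov : 1 ≤ a + b)
    (ζ : Fin 2 → ℝ → ℝ) (hζ0 : ∀ z, ζ 0 z = a * z) (hζ1 : ∀ z, ζ 1 z = b * z + 1 - b)
    (n : ℕ) {y : ℝ} (hy : y ∈ Set.Icc (0 : ℝ) 1) :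
    ∃ l : List (Fin 2), l.length = n ∧
      ∀ z ∈ Set.Icc (-r) (1 + r), |l.foldr ζ z - y| ≤ b ^ n * (1 + r) := by
  have hb : 0 < b := ha.trans_le hab
  induction n generalizing y with
  | zero =>
    refine ⟨[], rfl, fun z hz => ?_⟩
    obtain ⟨hz0, hz1⟩ := hz
    obtain ⟨hy0, hy1⟩ := hy
    rw [List.foldr_nil, pow_zero, one_mul, abs_le]
    constructor <;> linarith
  | succ n ih =>
    obtain ⟨hy0, hy1⟩ := hy
    rcases le_total y a with hya | hya
    · obtain ⟨l, hl, hlz⟩ := ih (y := y / a) ⟨by positivity, (div_le_one ha).2 hya⟩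
      refine ⟨0 :: l, by simp [hl], fun z hz => ?_⟩
      have key : a * l.foldr ζ z - y = a * (l.foldr ζ z - y / a) := by field_simp
      rw [List.foldr_cons, hζ0, key, abs_mul, abs_of_pos ha, pow_succ', mul_assoc]
      exact mul_le_mul hab (hlz z hz) (abs_nonneg _) hb.le
    · obtain ⟨l, hl, hlz⟩ := ih (y := (y - (1 - b)) / b)
        ⟨div_nonneg (by linarith) hb.le, (div_le_one hb).2 (by linarith)⟩
      refine ⟨1 :: l, by simp [hl], fun z hz => ?_⟩
      have key : b * l.foldr ζ z + 1 - b - y = b * (l.foldr ζ z - (y - (1 - b)) / b) := by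
        field_simp
        ring
      rw [List.foldr_cons, hζ1, key, abs_mul, abs_of_pos hb, pow_succ', mul_assoc]
      exact mul_le_mul_of_nonneg_left (hlz z hz) hb.le


/-- **Lemma `l_zeta_zeta`.** There is `μ₀ ∈ ℕ` and `ε* > 0` such that every
`z ∈ [−ε₀, 1+ε₀]` admits a word `(ι₁,…,ι_m)` in `{0,1}` of length `≤ μ₀`, independent of
`ε`, with `ζ_{ι₁} ∘ ⋯ ∘ ζ_{ι_m}(z) ∈ [1−λ₁+7ε, λ₀−7ε]` whenever `0 < ε ≤ ε*` and
`z ∈ [−ε₀, 1−λ₁+7ε] ∪ [λ₀−7ε, 1+ε₀]`. -/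
theorem stmt5 (lcs0 lcs1 ε₀ : ℝ)
    (h0 : 0 < lcs0) (h1 : lcs0 < 1/2) (h2 : 1/2 < lcs1) (h3 : lcs1 < 1)
    (h4 : 1 < lcs0 + lcs1) (h5 : 0 < ε₀) (h6 : lcs1 * (1 + ε₀) < 1)
    (ζ : Fin 2 → ℝ → ℝ)
    (hζ0 : ∀ z, ζ 0 z = lcs0 * z)
    (hζ1 : ∀ z, ζ 1 z = lcs1 * z + 1 - lcs1) :
    ∃ μ₀ : ℕ, ∃ εs : ℝ, 0 < εs ∧
      ∀ z ∈ Set.Icc (-ε₀) (1 + ε₀), ∃ l : List (Fin 2), l.length ≤ μ₀ ∧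
        ∀ ε : ℝ, 0 < ε → ε ≤ εs →
          z ∈ Set.Icc (-ε₀) (1 - lcs1 + 7*ε) ∪ Set.Icc (lcs0 - 7*ε) (1 + ε₀) →
          l.foldr ζ z ∈ Set.Icc (1 - lcs1 + 7*ε) (lcs0 - 7*ε) := by
  have hr : 0 < 1 + ε₀ := by linarith
  obtain ⟨n, hn⟩ := exists_pow_lt_of_lt_one
    (show 0 < (lcs0 + lcs1 - 1) / 4 / (1 + ε₀) from div_pos (by linarith) hr) h3
  rw [lt_div_iff₀ hr] at hn
  obtain ⟨l, hl, hlz⟩ := exists_word_abs_foldr_sub_le (r := ε₀) h0 (by linarith) h4.le ζ hζ0 hζ1 n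
    (y := (1 - lcs1 + lcs0) / 2) ⟨by linarith, by linarith⟩
  refine ⟨n, (lcs0 + lcs1 - 1) / 28, by linarith, fun z hz => ⟨l, hl.le, fun ε _ hε _ => ?_⟩⟩
  obtain ⟨hlo, hhi⟩ := abs_le.1 ((hlz z hz).trans hn.le)
  constructor <;> linarith
end

section
/- Let λ_cs0, λ_cs1, ε be real numbers with 0 < λ_cs0 < 1/2 < λ_cs1 < 1 < λ_cs0 + λ_cs1 and 0 < ε < (λ_cs0 + λ_cs1 − 1)/4. Let a ≤ b be real numbers. (1) If [a,b] ⊆ [1−λ_cs1+ε, 1−ε], then, setting a' = (a − 1 + λ_cs1)/λ_cs1 and b' = (b − 1 + λ_cs1)/λ_cs1 (so [a',b'] = ζ₁⁻¹([a,b])), one of the following holds: [a',b'] ⊆ [1−λ_cs1+ε, 1−ε], or [a',b'] ⊆ [ε, λ_cs0−ε], or [1−λ_cs1+2ε, λ_cs0−2ε] ⊆ [a',b']. (2) If [a,b] ⊆ [ε, λ_cs0−ε], then, setting a' = a/λ_cs0 and b' = b/λ_cs0 (so [a',b'] = ζ₀⁻¹([a,b])), the same trichotomy holds: [a',b'] ⊆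 [1−λ_cs1+ε, 1−ε], or [a',b'] ⊆ [ε, λ_cs0−ε], or [1−λ_cs1+2ε, λ_cs0−2ε] ⊆ [a',b']. -/
/-- An interval `[a, b] ⊆ [ε, 1 - ε]` lies in `[p + ε, 1 - ε]`, lies in `[ε, q - ε]`, or contains
`[p + 2 * ε, q - 2 * ε]`. -/
theorem Icc_subset_or_subset_or_middle_subset {p q ε a b : ℝ} (hε : 0 ≤ ε)
    (ha : ε ≤ a) (hb : b ≤ 1 - ε) :
    Set.Icc a b ⊆ Set.Icc (p + ε) (1 - ε) ∨ Set.Icc a b ⊆ Set.Icc ε (q - ε) ∨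
      Set.Icc (p + 2 * ε) (q - 2 * ε) ⊆ Set.Icc a b := by
  rcases le_or_gt (p + ε) a with hp | hp
  · exact Or.inl (Set.Icc_subset_Icc hp hb)
  rcases le_or_gt b (q - ε) with hq | hq
  · exact Or.inr (Or.inl (Set.Icc_subset_Icc ha hq))
  · exact Or.inr (Or.inr (Set.Icc_subset_Icc (by linarith) (by linarith)))

/-- **interval trichotomy for the backtracking condition.** For a
subinterval `[a,b]` of `[1−λ₁+ε, 1−ε]` (resp. of `[ε, λ₀−ε]`), its preimage
`ζ₁⁻¹([a,b])` (resp. `ζ₀⁻¹([a,b])`) is contained in `[1−λ₁+ε, 1−ε]`, or contained in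
`[ε, λ₀−ε]`, or contains the middle interval `[1−λ₁+2ε, λ₀−2ε]`. -/
theorem stmt6 (lcs0 lcs1 ε a b : ℝ)
    (h0 : 0 < lcs0) (h1 : lcs0 < 1/2) (h2 : 1/2 < lcs1) (h3 : lcs1 < 1)
    (h4 : 1 < lcs0 + lcs1) (hε0 : 0 < ε) (hε1 : ε < (lcs0 + lcs1 - 1)/4)
    (hab : a ≤ b) :
    (Set.Icc a b ⊆ Set.Icc (1 - lcs1 + ε) (1 - ε) →
      (Set.Icc ((a - 1 + lcs1)/lcs1) ((b - 1 + lcs1)/lcs1) ⊆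
          Set.Icc (1 - lcs1 + ε) (1 - ε) ∨
        Set.Icc ((a - 1 + lcs1)/lcs1) ((b - 1 + lcs1)/lcs1) ⊆
          Set.Icc ε (lcs0 - ε) ∨
        Set.Icc (1 - lcs1 + 2*ε) (lcs0 - 2*ε) ⊆
          Set.Icc ((a - 1 + lcs1)/lcs1) ((b - 1 + lcs1)/lcs1))) ∧
    (Set.Icc a b ⊆ Set.Icc ε (lcs0 - ε) →
      (Set.Icc (a/lcs0) (b/lcs0) ⊆ Set.Icc (1 - lcs1 + ε) (1 - ε) ∨
        Set.Icc (a/lcs0) (b/lcs0) ⊆ Set.Icc ε (lcs0 - ε) ∨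
        Set.Icc (1 - lcs1 + 2*ε) (lcs0 - 2*ε) ⊆ Set.Icc (a/lcs0) (b/lcs0))) := by
  have hl1 : 0 < lcs1 := by linarith
  constructor
  · intro h
    obtain ⟨ha, hb⟩ := (Set.Icc_subset_Icc_iff hab).1 h
    apply Icc_subset_or_subset_or_middle_subset hε0.le
    · rw [le_div_iff₀ hl1]
      nlinarith
    · rw [div_le_iff₀ hl1]
      nlinarith
  · intro h
    obtain ⟨ha, hb⟩ := (Set.Icc_subset_Icc_iff hab).1 h
    apply Icc_subset_or_subset_or_middle_subset hε0.le
    · rw [le_div_iff₀ h0]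
      nlinarith
    · rw [div_le_iff₀ h0]
      nlinarith
end

section
/- Let λ₀, λ₁, Λ, σ be positive real numbers with Λ > 1 and λ₁·Λ > 1, let η ∈ (0,1) and η₀ > 0 satisfy λ₀ · λ₁^{1+η₀} · Λ^{(2+η₀)(1+η₁)} < 1, where η₁ = 3η/(1−η). Let (n_k)_{k≥1}, (a_k)_{k≥1}, (b_k)_{k≥1} be sequences of nonnegative real numbers such that n_k = a_k + b_k and b_k ≤ (1+η₀)·a_k for all k, a_k → ∞ as k → ∞, and n_{k+i} ≤ (1+η)^i · n_k for all k ≥ 1 and all i ≥ 0. Define S_k = Σ_{i=0}^{∞} n_{k+i}/2^i, ξ_k = σ·Λ^{−S_k} and ρ_k = σ^{−1}·ξ_k^{1/2}. Then lim_{k→∞} ( λ₀^{a_k} · λ₁^{b_k} · ρ_k ) / ξ_{k+1} = 0. -/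
open Filter

/-- A sequence bounded by `(1 + η)^i * C` with `η < 1` is summable against the weights `2⁻ⁱ`. -/
theorem summable_div_two_pow_of_le {f : ℕ → ℝ} {η C : ℝ} (hη : 0 < η) (hη1 : η < 1)
    (hf : ∀ i, 0 ≤ f i) (hle : ∀ i, f i ≤ (1 + η) ^ i * C) :
    Summable (fun i => f i / 2 ^ i) ∧ ∑' i, f i / 2 ^ i ≤ 2 / (1 - η) * C := by
  have hgeom : HasSum (fun i : ℕ => ((1 + η) / 2) ^ i * C) ((1 - (1 + η) / 2)⁻¹ * C) :=
    (hasSum_geometric_of_lt_one (by linarith) (by linarith)).mul_right C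
  have hbound : ∀ i, f i / 2 ^ i ≤ ((1 + η) / 2) ^ i * C := fun i => by
    rw [div_pow, div_mul_eq_mul_div]
    exact div_le_div_of_nonneg_right (hle i) (by positivity)
  have hsum : Summable (fun i => f i / 2 ^ i) :=
    Summable.of_nonneg_of_le (fun i => div_nonneg (hf i) (by positivity)) hbound hgeom.summable
  refine ⟨hsum, (hsum.tsum_le_tsum hbound hgeom.summable).trans_eq ?_⟩
  have h1 : 1 - η ≠ 0 := by linarith
  have h2 : 1 - (1 + η) / 2 ≠ 0 := by intro h; apply h1; linarith
  rw [hgeom.tsum_eq]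
  congr 1
  rw [inv_eq_one_div, div_eq_div_iff h2 h1]
  ring

/-- With `S k = ∑ n (k + i) / 2 ^ i`, growth at rate `1 + η` controls `S (k + 1) - S k / 2`. -/
theorem tsum_succ_sub_half_tsum_le {n : ℕ → ℝ} {η : ℝ} (hη : 0 < η) (hη1 : η < 1)
    (hn : ∀ k, 0 ≤ n k) {k : ℕ} (hsub : ∀ i : ℕ, n (k + i) ≤ (1 + η) ^ i * n k) :
    (∑' i : ℕ, n (k + 1 + i) / 2 ^ i) - (∑' i : ℕ, n (k + i) / 2 ^ i) / 2 ≤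
      (1 + 3 * η / (1 - η)) * n k := by
  have hs := (summable_div_two_pow_of_le hη hη1 (fun i => hn (k + i)) hsub).1
  have hs' := (summable_div_two_pow_of_le (f := fun i => n (k + 1 + i)) (C := (1 + η) * n k)
    hη hη1 (fun i => hn _) (fun i => by
      have h := hsub (i + 1)
      rw [show k + (i + 1) = k + 1 + i by omega, pow_succ, mul_assoc] at h
      exact h)).2
  have hsplit : ∑' i : ℕ, n (k + i) / 2 ^ i =
      n k + (∑' i : ℕ, n (k + 1 + i) / 2 ^ i) / 2 := by
    rw [hs.tsum_eq_zero_add, ← tsum_div_const]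
    congr 1
    · simp
    · refine tsum_congr fun i => ?_
      rw [show k + (i + 1) = k + 1 + i by omega, pow_succ, div_div]
  rw [hsplit]
  have h1 : 1 - η ≠ 0 := by linarith
  have hc : (1 + 3 * η / (1 - η)) * n k =
      3 / 4 * (2 / (1 - η) * ((1 + η) * n k)) - n k / 2 := by
    field_simp
    ring
  rw [hc]
  linarith

/-- **Lemma 7.3.** Under the partial dissipativity condition
`λ₀ λ₁^{1+η₀} Λ^{(2+η₀)(1+η₁)} < 1` (with `η₁ = 3η/(1−η)`), the majority condition
`b k ≤ (1+η₀) a k` and the subexponential growth `n (k+i) ≤ (1+η)^i n k`, one has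
`λ₀^{a k} λ₁^{b k} ρ k = o(ξ (k+1))`, where `S k = Σ_i n(k+i)/2^i`, `ξ k = σ Λ^{−S k}`
and `ρ k = σ⁻¹ ξ k^{1/2}`. -/
theorem stmt8 (l0 l1 Λ σ η η₀ : ℝ)
    (hl0 : 0 < l0) (hl1 : 0 < l1) (hΛ1 : 1 < Λ) (hσ : 0 < σ)
    (hl1Λ : 1 < l1 * Λ) (hη : 0 < η) (hη1 : η < 1) (hη₀ : 0 < η₀)
    (hcond : l0 * l1 ^ (1 + η₀) * Λ ^ ((2 + η₀) * (1 + 3*η/(1-η))) < 1)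
    (n a b : ℕ → ℝ)
    (hn : ∀ k, 0 ≤ n k) (ha : ∀ k, 0 ≤ a k) (hb : ∀ k, 0 ≤ b k)
    (hnab : ∀ k, n k = a k + b k)
    (hmaj : ∀ k, b k ≤ (1 + η₀) * a k)
    (hatop : Tendsto a atTop atTop)
    (hsub : ∀ k : ℕ, 1 ≤ k → ∀ i : ℕ, n (k + i) ≤ (1 + η)^i * n k) :
    Tendsto
      (fun k : ℕ =>
        (l0 ^ (a k) * l1 ^ (b k) *
            (σ⁻¹ * (σ * Λ ^ (-(∑' i : ℕ, n (k + i) / 2^i))) ^ ((1:ℝ)/2))) /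
          (σ * Λ ^ (-(∑' i : ℕ, n (k + 1 + i) / 2^i))))
      atTop (nhds 0) := by
  have hΛ : 0 < Λ := by linarith
  set c : ℝ := 1 + 3 * η / (1 - η) with hc
  have hc1 : 1 ≤ c := by
    have : 0 ≤ 3 * η / (1 - η) := div_nonneg (by linarith) (by linarith)
    linarith
  set S : ℕ → ℝ := fun k => ∑' i : ℕ, n (k + i) / 2 ^ i with hS
  set q : ℝ := Real.log l0 + (1 + η₀) * Real.log l1 + (2 + η₀) * c * Real.log Λ with hq_def
  have hq : q < 0 := by
    have h := Real.log_neg (by positivity) hcond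
    rwa [Real.log_mul (by positivity) (by positivity), Real.log_mul (by positivity) (by positivity),
      Real.log_rpow hl1, Real.log_rpow hΛ] at h
  have hlogΛ : 0 < Real.log Λ := Real.log_pos hΛ1
  have hlog : 0 ≤ Real.log l1 + c * Real.log Λ := by
    have h := Real.log_pos hl1Λ
    rw [Real.log_mul hl1.ne' hΛ.ne'] at h
    nlinarith
  have hlim : Tendsto (fun k => σ⁻¹ * σ ^ ((1 : ℝ) / 2) / σ * Real.exp (q * a k)) atTop (nhds 0) := by
    simpa using (Real.tendsto_exp_atBot.comp (hatop.const_mul_atTop_of_neg hq)).const_mul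
      (σ⁻¹ * σ ^ ((1 : ℝ) / 2) / σ)
  refine squeeze_zero' (Eventually.of_forall fun k => by positivity) ?_ hlim
  filter_upwards [eventually_ge_atTop 1] with k hk
  have hexp : S (k + 1) - S k / 2 ≤ c * n k := tsum_succ_sub_half_tsum_le hη hη1 hn (hsub k hk)
  have heq : (l0 ^ (a k) * l1 ^ (b k) * (σ⁻¹ * (σ * Λ ^ (-(S k))) ^ ((1:ℝ)/2))) /
      (σ * Λ ^ (-(S (k + 1)))) = σ⁻¹ * σ ^ ((1 : ℝ) / 2) / σ * Real.exp (Real.log l0 * a k +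
        Real.log l1 * b k + Real.log Λ * (S (k + 1) - S k / 2)) := by
    rw [Real.mul_rpow hσ.le (by positivity), ← Real.rpow_mul hΛ.le,
      show Real.log l0 * a k + Real.log l1 * b k + Real.log Λ * (S (k + 1) - S k / 2) =
        Real.log l0 * a k + Real.log l1 * b k + Real.log Λ * (-(S k) * (1 / 2)) -
          Real.log Λ * (-(S (k + 1))) by ring,
      Real.exp_sub, Real.exp_add, Real.exp_add, ← Real.rpow_def_of_pos hl0,
      ← Real.rpow_def_of_pos hl1, ← Real.rpow_def_of_pos hΛ, ← Real.rpow_def_of_pos hΛ]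
    have := (Real.rpow_pos_of_pos hΛ (-(S (k + 1)))).ne'
    field_simp
  refine heq.trans_le (mul_le_mul_of_nonneg_left (Real.exp_le_exp.2 ?_) (by positivity))
  calc Real.log l0 * a k + Real.log l1 * b k + Real.log Λ * (S (k + 1) - S k / 2)
      ≤ Real.log l0 * a k + Real.log l1 * b k + Real.log Λ * (c * n k) := by gcongr
    _ = (Real.log l0 + c * Real.log Λ) * a k + (Real.log l1 + c * Real.log Λ) * b k := by
        rw [hnab k]; ring
    _ ≤ (Real.log l0 + c * Real.log Λ) * a k +
          (Real.log l1 + c * Real.log Λ) * ((1 + η₀) * a k) := by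
        gcongr
        exact hmaj k
    _ = q * a k := by rw [hq_def]; ring
end

section
/- Let v : ℤ → {0,1} satisfy the majority condition, i.e. liminf_{n→∞} p_n(v) ≥ 1/2. Let C > 0 and let (α_k)_{k≥1}, (n̂_k)_{k≥1}, (z_k)_{k≥1} be sequences of natural numbers such that for all k ≥ 1: |α_{k+1} − α_k − k²| ≤ C·k, |n̂_k − k²| ≤ C·k, z_k ≤ n̂_k, and |z_k − #{ j ∈ ℤ : α_k < j ≤ α_k + k² and v_j = 0 }| ≤ C·k. Then for every η > 0 there exists k₂ ∈ ℕ such that z_k > (1/2 − η)·n̂_k for all k ≥ k₂. -/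
open Filter
open scoped Classical

/-- The quantity `p_n(v)`: the proportion of indices `j ∈ ℕ` with
`n − (3n)^{2/3} < j ≤ n` at which `v j = 0`, normalized by `(3n)^{2/3}`. -/
noncomputable def pMaj (v : ℤ → Fin 2) (n : ℕ) : ℝ :=
  (((Finset.range (n + 1)).filter fun j : ℕ =>
      ((n : ℝ) - (3 * (n : ℝ)) ^ ((2:ℝ)/3) < (j : ℝ)) ∧ v (j : ℤ) = 0).card : ℝ) /
    (3 * (n : ℝ)) ^ ((2:ℝ)/3)

/-- Increments `k² + O(k)` force growth `k³/3 + O(k²)`. -/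
lemma exists_abs_sub_cube_div_three_le {a : ℕ → ℝ} {C : ℝ} (hC : 0 < C)
    (ha : ∀ k : ℕ, 1 ≤ k → |a (k + 1) - a k - (k : ℝ) ^ 2| ≤ C * k) :
    ∃ D : ℝ, 0 < D ∧ ∀ k : ℕ, 1 ≤ k → |a k - (k : ℝ) ^ 3 / 3| ≤ D * (k : ℝ) ^ 2 := by
  refine ⟨|a 1| + C + 2, by positivity, fun k hk => ?_⟩
  induction k, hk using Nat.le_induction with
  | base =>
    have h := abs_le.1 (le_refl |a 1|)
    rw [abs_le]
    constructor <;> norm_num <;> linarith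
  | succ k hk ih =>
    have hk' : (1 : ℝ) ≤ k := by exact_mod_cast hk
    have h := abs_le.1 (ha k hk)
    rw [abs_le] at ih ⊢
    have h0 : 0 ≤ |a 1| * k := by positivity
    have hCk : 0 < C * k := by positivity
    have h1 := abs_nonneg (a 1)
    push_cast
    constructor <;> nlinarith

/-- If `x = k³ + O(k²)` then `x^{2/3} = k² + O(k)`. -/
lemma abs_rpow_two_thirds_sub_sq_le {x k E : ℝ} (hx : 0 ≤ x) (hk : 1 ≤ k)
    (h : |x - k ^ 3| ≤ E * k ^ 2) :
    |x ^ ((2 : ℝ) / 3) - k ^ 2| ≤ (2 * E + E ^ 2) * k := by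
  obtain ⟨c, hc, rfl⟩ : ∃ c : ℝ, 0 ≤ c ∧ c ^ 3 = x :=
    ⟨x ^ ((1 : ℝ) / 3), by positivity, by
      rw [← Real.rpow_natCast, ← Real.rpow_mul hx]; norm_num⟩
  have hpow : (c ^ 3) ^ ((2 : ℝ) / 3) = c ^ 2 := by
    rw [← Real.rpow_natCast c 3, ← Real.rpow_mul hc, ← Real.rpow_natCast c 2]; norm_num
  have hk2 : 0 < k ^ 2 := by positivity
  have hck : |c - k| ≤ E := by
    refine le_of_mul_le_mul_right ?_ hk2
    calc |c - k| * k ^ 2 ≤ |c - k| * (c ^ 2 + c * k + k ^ 2) := by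
          gcongr
          nlinarith [mul_nonneg hc (zero_le_one.trans hk), sq_nonneg c]
      _ = |c ^ 3 - k ^ 3| := by
          rw [← abs_of_nonneg (show 0 ≤ c ^ 2 + c * k + k ^ 2 by positivity), ← abs_mul]
          ring_nf
      _ ≤ E * k ^ 2 := h
  have hE : 0 ≤ E := (abs_nonneg _).trans hck
  rw [hpow, show c ^ 2 - k ^ 2 = (c - k) * (c + k) by ring, abs_mul,
    abs_of_nonneg (show 0 ≤ c + k by positivity)]
  calc |c - k| * (c + k) ≤ E * (2 * k + E) := by
        refine mul_le_mul hck ?_ (by positivity) hE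
        linarith [(abs_le.1 hck).2]
    _ ≤ (2 * E + E ^ 2) * k := by nlinarith [sq_nonneg E]

/-- The zeros of `v` in `(m + d - L, m + d]` outnumber those in `(m, m + d]` by at most
`|L - d| + 1`. -/
lemma card_filter_window_le (v : ℤ → Fin 2) (m d : ℕ) (L : ℝ) :
    (((Finset.range (m + d + 1)).filter fun j : ℕ =>
      (((m + d : ℕ) : ℝ) - L < (j : ℝ)) ∧ v (j : ℤ) = 0).card : ℝ) ≤
    (((Finset.Icc ((m : ℤ) + 1) ((m : ℤ) + (d : ℤ))).filter fun j => v j = 0).card : ℝ)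
      + (|L - d| + 1) := by
  set A := (Finset.range (m + d + 1)).filter fun j : ℕ =>
      (((m + d : ℕ) : ℝ) - L < (j : ℝ)) ∧ v (j : ℤ) = 0 with hA
  set B := (Finset.Icc ((m : ℤ) + 1) ((m : ℤ) + (d : ℤ))).filter fun j => v j = 0 with hB
  set G := Finset.Icc (⌊((m + d : ℕ) : ℝ) - L⌋ + 1) (m : ℤ) with hG
  have hsub : A.image (fun j : ℕ => (j : ℤ)) ⊆ B ∪ G := by
    intro x hx
    obtain ⟨j, hj, rfl⟩ := Finset.mem_image.1 hx
    obtain ⟨hj1, hj2, hj3⟩ := Finset.mem_filter.1 hj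
    rw [Finset.mem_range] at hj1
    by_cases hjm : j ≤ m
    · refine Finset.mem_union_right _ (Finset.mem_Icc.2 ⟨?_, by exact_mod_cast hjm⟩)
      exact Int.add_one_le_iff.2 (Int.floor_lt.2 (by exact_mod_cast hj2))
    · refine Finset.mem_union_left _ (Finset.mem_filter.2 ⟨Finset.mem_Icc.2 ⟨?_, ?_⟩, hj3⟩) <;>
        omega
  have hcard : A.card ≤ B.card + G.card := by
    rw [← Finset.card_image_of_injective A (Nat.cast_injective (R := ℤ))]
    exact (Finset.card_le_card hsub).trans (Finset.card_union_le _ _)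
  have hGcard : (G.card : ℝ) ≤ |L - d| + 1 := by
    have hf := Int.lt_floor_add_one (((m + d : ℕ) : ℝ) - L)
    have hG' : (G.card : ℤ) = max ((m : ℤ) - ⌊((m + d : ℕ) : ℝ) - L⌋) 0 := by
      rw [hG, Int.card_Icc, Int.toNat_eq_max]; congr 1; ring
    have hG'' : (G.card : ℝ) = max ((m : ℝ) - ⌊((m + d : ℕ) : ℝ) - L⌋) 0 := by
      exact_mod_cast congrArg (Int.cast : ℤ → ℝ) hG'
    rw [hG'']
    refine max_le ?_ (by positivity)
    push_cast at hf ⊢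
    linarith [le_abs_self (L - d)]
  calc (A.card : ℝ) ≤ B.card + G.card := by exact_mod_cast hcard
    _ ≤ _ := by gcongr

/-- Under the majority condition `liminf pₙ(v) ≥ 1/2` and the
`O(k)`-comparisons between the block structure and the quantities `n̂ k`, `z k`, the
number `z k` of zero entries satisfies `z k > (1/2 − η) n̂ k` for all large `k`. -/
theorem stmt9 (v : ℤ → Fin 2)
    (hmaj : (1/2 : ℝ) ≤ liminf (fun n : ℕ => pMaj v n) atTop)
    (C : ℝ) (hC : 0 < C)
    (α nh z : ℕ → ℕ)
    (hα : ∀ k : ℕ, 1 ≤ k → |(α (k+1) : ℝ) - (α k : ℝ) - (k : ℝ)^2| ≤ C * k)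
    (hnh : ∀ k : ℕ, 1 ≤ k → |(nh k : ℝ) - (k : ℝ)^2| ≤ C * k)
    (hznh : ∀ k : ℕ, 1 ≤ k → z k ≤ nh k)
    (hz : ∀ k : ℕ, 1 ≤ k →
      |(z k : ℝ) -
        (((Finset.Icc ((α k : ℤ) + 1) ((α k : ℤ) + (k : ℤ)^2)).filter
            fun j => v j = 0).card : ℝ)| ≤ C * k) :
    ∀ η : ℝ, 0 < η → ∃ k₂ : ℕ, ∀ k, k₂ ≤ k →
      ((1:ℝ)/2 - η) * (nh k : ℝ) < (z k : ℝ) := by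
  intro η hη
  obtain ⟨D, hD, hαD⟩ := exists_abs_sub_cube_div_three_le (a := fun k => (α k : ℝ)) hC hα
  set ε : ℝ := min η (1 / 4) / 2 with hε
  have hε0 : 0 < ε := by positivity
  have hεη : 2 * ε ≤ η := by rw [hε]; linarith [min_le_left η (1 / 4)]
  have hε4 : 2 * ε ≤ 1 / 4 := by rw [hε]; linarith [min_le_right η (1 / 4)]
  have hbdd : IsBoundedUnder (· ≥ ·) atTop fun n : ℕ => pMaj v n :=
    isBoundedUnder_of ⟨0, fun n => by unfold pMaj; positivity⟩
  obtain ⟨N, hN⟩ := eventually_atTop.1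
    (eventually_lt_of_lt_liminf (show 1 / 2 - ε < _ by linarith) hbdd)
  set E : ℝ := 3 * (D + 1) with hE
  set F : ℝ := 2 * E + E ^ 2 with hF
  have hF0 : 0 < F := by positivity
  obtain ⟨K, hK⟩ := exists_nat_gt ((2 * F + 2 * C + 1) / ε)
  rw [div_lt_iff₀ hε0] at hK
  refine ⟨max (max N 1) K, fun k hk => ?_⟩
  have hkN : N ≤ k := by omega
  have hk1 : 1 ≤ k := by omega
  have hkK : (K : ℝ) ≤ k := by exact_mod_cast (show K ≤ k by omega)
  have hk1' : (1 : ℝ) ≤ k := by exact_mod_cast hk1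
  have hkn : k ≤ α k + k ^ 2 := by nlinarith
  have hp := hN (α k + k ^ 2) (hkN.trans hkn)
  have hα3 : |3 * ((α k + k ^ 2 : ℕ) : ℝ) - (k : ℝ) ^ 3| ≤ E * (k : ℝ) ^ 2 := by
    have h := abs_le.1 (hαD k hk1)
    rw [abs_le]
    push_cast
    constructor <;> nlinarith
  have hL := abs_rpow_two_thirds_sub_sq_le (by positivity) hk1' hα3
  have hw := card_filter_window_le v (α k) (k ^ 2) ((3 * ((α k + k ^ 2 : ℕ) : ℝ)) ^ ((2 : ℝ) / 3))
  have hn0 : (0 : ℝ) < ((α k + k ^ 2 : ℕ) : ℝ) := by exact_mod_cast hk1.trans hkn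
  unfold pMaj at hp
  rw [lt_div_iff₀ (by positivity)] at hp
  set L := (3 * ((α k + k ^ 2 : ℕ) : ℝ)) ^ ((2 : ℝ) / 3)
  have hzk := (abs_le.1 (hz k hk1)).1
  have hnk := (abs_le.1 (hnh k hk1)).2
  rw [Nat.cast_pow, Nat.cast_pow] at hw
  set b := (((Finset.Icc ((α k : ℤ) + 1) ((α k : ℤ) + (k : ℤ)^2)).filter
            fun j => v j = 0).card : ℝ)
  have hlow : (1 / 2 - ε) * L < z k + C * k + F * k + 1 := by linarith
  have hL' : (1 / 2 - ε) * ((k : ℝ) ^ 2 - F * k) ≤ (1 / 2 - ε) * L := by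
    gcongr
    · linarith
    · linarith [(abs_le.1 hL).1]
  have hnhk : (1 / 2 - η) * (nh k : ℝ) ≤ (1 / 2 - 2 * ε) * ((k : ℝ) ^ 2 + C * k) := by
    calc (1 / 2 - η) * (nh k : ℝ) ≤ (1 / 2 - 2 * ε) * nh k := by gcongr
      _ ≤ _ := by
        gcongr
        · linarith
        · linarith
  have hquad : (2 * F + 2 * C + 1) * k < ε * (k : ℝ) ^ 2 := by
    have hlt : 2 * F + 2 * C + 1 < ε * k := by
      linarith [mul_le_mul_of_nonneg_right hkK hε0.le]
    linarith [mul_lt_mul_of_pos_right hlt (zero_lt_one.trans_le hk1')]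
  have hFk : 0 < F * k := by positivity
  have hCk : 0 < C * k := by positivity
  nlinarith [mul_pos hε0 hFk, mul_pos hε0 hCk]
end

section
/- Let C > 0 and let (α_k)_{k≥1} be a strictly increasing sequence of natural numbers such that α_k + k² + 1 ≤ α_{k+1} and α_{k+1} − (α_k + k²) ≤ C·k for every k ≥ 1. Set β_k = k² and I_k = [α_k, α_k + β_k] ∩ ℕ. Then lim_{N→∞} #{0 ≤ n ≤ N−1 : n ∈ ⋃_k I_k} / N = 1, i.e. the pair (α_k),(β_k) satisfies (DEI). -/
open Filter
open scoped Classical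

/-- Passing from `range a` to `range N` adds to a filtered set only elements of `[b, N)`, if the
predicate fails on `[a, b)`. -/
lemma card_filter_range_le_add_sub (q : ℕ → Prop) [DecidablePred q] (a b N : ℕ)
    (h : ∀ n, a ≤ n → n < b → ¬ q n) :
    ((Finset.range N).filter q).card ≤ ((Finset.range a).filter q).card + (N - b) := by
  rw [← Nat.card_Ico b N]
  refine (Finset.card_le_card fun n hn => ?_).trans (Finset.card_union_le _ _)
  simp only [Finset.mem_union, Finset.mem_filter, Finset.mem_range, Finset.mem_Ico] at hn ⊢
  by_cases hna : n < a
  · exact Or.inl ⟨hna, hn.2⟩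
  · by_cases hnb : n < b
    · exact absurd hn.2 (h n (not_lt.mp hna) hnb)
    · exact Or.inr ⟨not_lt.mp hnb, hn.1⟩

/-- If the intervals `[α k, α k + k²]` avoid `q` and consecutive ones are at distance at most
`C * k`, then beyond `α m` the set where `q` holds has relative frequency at most `C / m`. -/
lemma card_filter_range_le_of_gap_le {C : ℝ} (hC : 0 ≤ C) {α : ℕ → ℕ} {q : ℕ → Prop}
    [DecidablePred q] {m : ℕ}
    (hm : 1 ≤ m)
    (hgap : ∀ k : ℕ, 1 ≤ k → (α (k+1) : ℝ) - ((α k : ℝ) + (k : ℝ)^2) ≤ C * k)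
    (hq : ∀ k, 1 ≤ k → ∀ n, α k ≤ n → n ≤ α k + k^2 → ¬ q n) {k : ℕ} (hk : m ≤ k) :
    ∀ N ≤ α k, (((Finset.range N).filter q).card : ℝ) ≤ α m + C / m * N := by
  have hm0 : (0 : ℝ) < m := by exact_mod_cast hm
  induction k, hk using Nat.le_induction with
  | base =>
    intro N hN
    have h : ((Finset.range N).filter q).card ≤ α m :=
      (Finset.card_filter_le _ _).trans (by simpa using hN)
    have h' : (((Finset.range N).filter q).card : ℝ) ≤ α m := by exact_mod_cast h
    have : 0 ≤ C / m * N := by positivity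
    linarith
  | succ k hk ih =>
    intro N hN
    rcases le_or_gt N (α k) with hNk | hNk
    · exact ih N hNk
    have hk1 : 1 ≤ k := hm.trans hk
    have hcard := card_filter_range_le_add_sub q (α k) (α k + k^2) N
      fun n h₁ h₂ => hq k hk1 n h₁ h₂.le
    have hih := ih (α k) le_rfl
    have hcard' : (((Finset.range N).filter q).card : ℝ) ≤
        ((Finset.range (α k)).filter q).card + ((N - (α k + k^2) : ℕ) : ℝ) := by
      exact_mod_cast hcard
    have hsub : ((N - (α k + k^2) : ℕ) : ℝ) ≤ C / m * ((N : ℝ) - α k) := by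
      rcases le_total N (α k + k^2) with h | h
      · have : (α k : ℝ) ≤ N := by exact_mod_cast hNk.le
        rw [Nat.sub_eq_zero_of_le h, Nat.cast_zero]
        exact mul_nonneg (by positivity) (by linarith)
      · have h₁ : (α k : ℝ) + (k : ℝ)^2 ≤ N := by exact_mod_cast h
        have h₂ : (N : ℝ) ≤ α (k+1) := by exact_mod_cast hN
        have h₃ : (m : ℝ) ≤ k := by exact_mod_cast hk
        rw [Nat.cast_sub h]
        push_cast
        calc (N : ℝ) - (α k + (k : ℝ)^2) ≤ C * k := by linarith [hgap k hk1]
          _ = C / m * (m * k) := by field_simp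
          _ ≤ C / m * ((N : ℝ) - α k) := by
            gcongr
            nlinarith
    linarith

/-- If `α` is strictly increasing with `α k + k² + 1 ≤ α (k+1)` and
`α (k+1) − (α k + k²) ≤ C k` for all `k ≥ 1`, then the intervals
`I k = [α k, α k + k²]` have asymptotic density `1`, i.e. (DEI) holds with `β k = k²`. -/
theorem stmt11 (C : ℝ) (hC : 0 < C) (α : ℕ → ℕ)
    (hmono : ∀ k : ℕ, 1 ≤ k → α k < α (k+1))
    (hgap : ∀ k : ℕ, 1 ≤ k → α k + k^2 + 1 ≤ α (k+1))
    (hgap' : ∀ k : ℕ, 1 ≤ k → (α (k+1) : ℝ) - ((α k : ℝ) + (k : ℝ)^2) ≤ C * k) :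
    Tendsto
      (fun N : ℕ =>
        (((Finset.range N).filter fun n =>
            ∃ k, 1 ≤ k ∧ n ∈ Finset.Icc (α k) (α k + k^2)).card : ℝ) / N)
      atTop (nhds 1) := by
  set p : ℕ → Prop := fun n => ∃ k, 1 ≤ k ∧ n ∈ Finset.Icc (α k) (α k + k^2)
  have hbig : ∀ k, k ≤ α (k+1) := by
    intro k
    induction k with
    | zero => exact Nat.zero_le _
    | succ k ih => exact Nat.succ_le_of_lt (ih.trans_lt (hmono (k+1) (by omega)))
  have hbound : ∀ m, 1 ≤ m → ∀ N : ℕ,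
      (((Finset.range N).filter fun n => ¬ p n).card : ℝ) ≤ α m + C / m * N := by
    intro m hm N
    refine card_filter_range_le_of_gap_le (k := N + m + 1) hC.le hm hgap' ?_ (by omega) N
      ((by omega : N ≤ N + m).trans (hbig (N + m)))
    exact fun k hk n h₁ h₂ hn => hn ⟨k, hk, Finset.mem_Icc.mpr ⟨h₁, h₂⟩⟩
  rw [Metric.tendsto_atTop]
  intro ε hε
  obtain ⟨m, hm⟩ := exists_nat_gt (2 * C / ε)
  have hm0 : (0 : ℝ) < m := lt_trans (by positivity) hm
  obtain ⟨M, hM⟩ := exists_nat_gt (2 * (α m : ℝ) / ε)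
  have hM0 : (0 : ℝ) < M := lt_of_le_of_lt (by positivity) hM
  refine ⟨M, fun N hN => ?_⟩
  have hMN : (M : ℝ) ≤ N := by exact_mod_cast hN
  have hN0 : (0 : ℝ) < N := hM0.trans_le hMN
  have hsum : (((Finset.range N).filter p).card : ℝ) +
      ((Finset.range N).filter fun n => ¬ p n).card = N := by
    have h := Finset.card_filter_add_card_filter_not (s := Finset.range N) p
    rw [Finset.card_range] at h
    exact_mod_cast h
  have hb := hbound m (by exact_mod_cast hm0) N
  have hCm : C / m < ε / 2 := by
    rw [div_lt_iff₀ hε] at hm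
    rw [div_lt_iff₀ hm0]
    linarith
  have hα : (α m : ℝ) < ε / 2 * N := by
    rw [div_lt_iff₀ hε] at hM
    nlinarith
  have hCN : C / m * N < ε / 2 * N := mul_lt_mul_of_pos_right hCm hN0
  have heq : (((Finset.range N).filter p).card : ℝ) / N - 1 =
      -((((Finset.range N).filter fun n => ¬ p n).card : ℝ) / N) := by
    rw [← sub_eq_iff_eq_add.mpr hsum.symm]
    field_simp
    ring
  rw [Real.dist_eq, heq, abs_neg, abs_of_nonneg (by positivity), div_lt_iff₀ hN0]
  linarith
end

section
/- Let C > 0, q ∈ ℕ, and let (α_k)_{k≥1} be a strictly increasing sequence of natural numbers such that α_k + k² ≤ α_{k+1} and α_{k+1} − (α_k + k²) ≤ C·(k+1) for every k ≥ 1. For each k ≥ 2 let γ_k be the greatest natural number with 2γ_k ≤ k², and define I_k^{(q)} = ( [α_k+q, α_k+γ_k−q] ∪ [α_k+γ_k+q, α_k+2γ_k−q] ) ∩ ℕ if 2q ≤ γ_k, and I_k^{(q)} = ∅ otherwise. Then lim_{N→∞} #{0 ≤ n ≤ N−1 : n ∈ ⋃_{k≥2} I_k^{(q)}} / N = 1;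 in particular, for every ε > 0 there exists N₀ such that #{ n ∈ [0, N−1] ∩ ℕ : n ∉ ⋃_{k≥2} I_k^{(q)} } < N·ε for all N ≥ N₀. -/
open Filter
open scoped Classical

/-- If the number of exceptions to `P` below `N` is at most `A + ε N` for every `ε > 0`
(with `A` depending on `ε`), then it is eventually smaller than `N ε`. -/
theorem eventually_card_not_lt {P : ℕ → Prop} [DecidablePred P]
    (h : ∀ ε : ℝ, 0 < ε → ∃ A : ℝ, ∀ N : ℕ,
      (((Finset.range N).filter fun n => ¬ P n).card : ℝ) ≤ A + ε * N)
    (ε : ℝ) (hε : 0 < ε) :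
    ∃ N₀ : ℕ, ∀ N, N₀ ≤ N →
      (((Finset.range N).filter fun n => ¬ P n).card : ℝ) < (N : ℝ) * ε := by
  obtain ⟨A, hA⟩ := h (ε / 2) (by positivity)
  obtain ⟨N₀, hN₀⟩ := exists_nat_gt (2 * A / ε)
  refine ⟨N₀, fun N hN => (hA N).trans_lt ?_⟩
  have hlt : 2 * A / ε < N := hN₀.trans_le (by exact_mod_cast hN)
  rw [div_lt_iff₀ hε] at hlt
  linarith

theorem tendsto_card_div_of_card_not_lt {P : ℕ → Prop} [DecidablePred P]
    (h : ∀ ε : ℝ, 0 < ε → ∃ N₀ : ℕ, ∀ N, N₀ ≤ N →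
      (((Finset.range N).filter fun n => ¬ P n).card : ℝ) < (N : ℝ) * ε) :
    Tendsto (fun N : ℕ => (((Finset.range N).filter P).card : ℝ) / N) atTop (nhds 1) := by
  rw [Metric.tendsto_atTop]
  intro ε hε
  obtain ⟨N₀, hN₀⟩ := h ε hε
  refine ⟨N₀ + 1, fun N hN => ?_⟩
  have hN0 : (0 : ℝ) < N := by exact_mod_cast (by omega : 0 < N)
  have hlt := hN₀ N (by omega)
  have hsum : (((Finset.range N).filter P).card : ℝ)
      + ((Finset.range N).filter fun n => ¬ P n).card = N := by
    exact_mod_cast (Finset.card_filter_add_card_filter_not (s := Finset.range N) P).trans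
      (Finset.card_range N)
  have heq : (((Finset.range N).filter P).card : ℝ) / N - 1
      = -((((Finset.range N).filter fun n => ¬ P n).card : ℝ) / N) := by
    field_simp
    linarith
  rw [Real.dist_eq, heq, abs_neg, abs_of_nonneg (by positivity), div_lt_iff₀ hN0]
  linarith

/-- If every block `[α k, α (k + 1)]` with `k > m` contributes at most `ε (k - 1)²` exceptions
and has length at least `k²`, then there are at most `α (m + 1) + 2 ε N` exceptions below `N`. -/
theorem card_filter_le_of_block_le {Q : ℕ → Prop} [DecidablePred Q] {α : ℕ → ℕ} {ε : ℝ}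
    (hε : 0 < ε) (m : ℕ) (hmono : ∀ k, 1 ≤ k → α k < α (k + 1))
    (hgap : ∀ k, 1 ≤ k → α k + k ^ 2 ≤ α (k + 1))
    (hblock : ∀ j N, m ≤ j → 1 ≤ j → α (j + 1) ≤ N → N ≤ α (j + 2) →
      (((Finset.range N).filter Q).card : ℝ)
        ≤ ((Finset.range (α (j + 1))).filter Q).card + ε * (j : ℝ) ^ 2)
    (hm : 1 ≤ m) (N : ℕ) :
    (((Finset.range N).filter Q).card : ℝ) ≤ α (m + 1) + 2 * ε * N := by
  have htriv : ∀ N, (((Finset.range N).filter Q).card : ℝ) ≤ N := fun N => by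
    exact_mod_cast (Finset.card_filter_le _ _).trans (Finset.card_range N).le
  have hend : ∀ i, (((Finset.range (α (m + i + 1))).filter Q).card : ℝ)
      ≤ α (m + 1) + ε * α (m + i + 1) := by
    intro i
    induction i with
    | zero => exact (htriv _).trans (le_add_of_nonneg_right (by positivity))
    | succ i ih =>
      have hb := hblock (m + i) (α (m + i + 2)) (by omega) (by omega)
        (hmono (m + i + 1) (by omega)).le le_rfl
      have hg : ((α (m + i + 1) : ℝ)) + ((m + i : ℕ) : ℝ) ^ 2 ≤ α (m + i + 2) := by
        have : α (m + i + 1) + (m + i + 1) ^ 2 ≤ α (m + i + 2) := hgap (m + i + 1) (by omega)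
        have hsq : (m + i) ^ 2 ≤ (m + i + 1) ^ 2 := Nat.pow_le_pow_left (by omega) 2
        exact_mod_cast (by omega : α (m + i + 1) + (m + i) ^ 2 ≤ α (m + i + 2))
      have := mul_le_mul_of_nonneg_left hg hε.le
      rw [show m + (i + 1) + 1 = m + i + 2 by ring]
      linarith
  have hall : ∀ i N, N ≤ α (m + i + 1) →
      (((Finset.range N).filter Q).card : ℝ) ≤ α (m + 1) + 2 * ε * N := by
    intro i
    induction i with
    | zero =>
      intro N hN
      have : (N : ℝ) ≤ α (m + 1) := by exact_mod_cast hN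
      have := htriv N
      have : 0 ≤ 2 * ε * N := by positivity
      linarith
    | succ i ih =>
      intro N hN
      rcases le_total N (α (m + i + 1)) with h | h
      · exact ih N h
      · have hb := hblock (m + i) N (by omega) (by omega) h hN
        have hsq : ((m + i : ℕ) : ℝ) ^ 2 ≤ N := by
          have := hgap (m + i) (by omega)
          exact_mod_cast (by omega : (m + i) ^ 2 ≤ N)
        have hα : (α (m + i + 1) : ℝ) ≤ N := by exact_mod_cast h
        have := mul_le_mul_of_nonneg_left hsq hε.le
        have := mul_le_mul_of_nonneg_left hα hε.le
        have := hend i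
        linarith
  have hge : ∀ i, i ≤ α (m + i + 1) := by
    intro i
    induction i with
    | zero => exact Nat.zero_le _
    | succ i ih => exact Nat.succ_le_of_lt (ih.trans_lt (hmono (m + i + 1) (by omega)))
  exact hall N N (hge N)

/-- Between `a` and `b`, the points outside the two `q`-trimmed halves of `[a, a + 2 g]` number
at most `b - (a + 2 g) + 4 q`. -/
theorem card_filter_le_of_trimmed {Q : ℕ → Prop} [DecidablePred Q] {a b g q N : ℕ}
    (hN : N ≤ b) (hab : a + 2 * g ≤ b) (hq : 2 * q ≤ g)
    (hQ : ∀ n, Q n →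
      n ∉ Finset.Icc (a + q) (a + g - q) ∪ Finset.Icc (a + g + q) (a + 2 * g - q)) :
    ((Finset.range N).filter Q).card
      ≤ ((Finset.range a).filter Q).card + (b - (a + 2 * g) + 4 * q) := by
  have hsub : (Finset.range N).filter Q ⊆ (Finset.range a).filter Q ∪
      (Finset.Ico a (a + q) ∪ (Finset.Ico (a + g - q) (a + g + q) ∪
        Finset.Ico (a + 2 * g - q) b)) := by
    intro n hn
    simp only [Finset.mem_filter, Finset.mem_range] at hn
    have hnot := hQ n hn.2
    simp only [Finset.mem_union, Finset.mem_Icc, Finset.mem_filter, Finset.mem_range,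
      Finset.mem_Ico, hn.2, and_true] at hnot ⊢
    omega
  have h₁ := Finset.card_le_card hsub
  have h₂ := Finset.card_union_le ((Finset.range a).filter Q)
    (Finset.Ico a (a + q) ∪ (Finset.Ico (a + g - q) (a + g + q) ∪
      Finset.Ico (a + 2 * g - q) b))
  have h₃ := Finset.card_union_le (Finset.Ico a (a + q))
    (Finset.Ico (a + g - q) (a + g + q) ∪ Finset.Ico (a + 2 * g - q) b)
  have h₄ := Finset.card_union_le (Finset.Ico (a + g - q) (a + g + q))
    (Finset.Ico (a + 2 * g - q) b)
  simp only [Nat.card_Ico] at h₃ h₄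
  omega

/-- The union over `k ≥ 2` of the `q`-trimmed halves
`[α k + q, α k + γ k − q] ∪ [α k + γ k + q, α k + 2 γ k − q]` (with `γ k = ⌊k²/2⌋`,
and empty unless `2q ≤ γ k`) of the blocks `[α k, α k + k²]` has asymptotic density `1`;
in particular the complement in `[0, N−1]` has cardinality `< N ε` for large `N`. -/
theorem stmt12 (C : ℝ) (hC : 0 < C) (q : ℕ) (α : ℕ → ℕ)
    (hmono : ∀ k : ℕ, 1 ≤ k → α k < α (k+1))
    (hgap : ∀ k : ℕ, 1 ≤ k → α k + k^2 ≤ α (k+1))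
    (hgap' : ∀ k : ℕ, 1 ≤ k → (α (k+1) : ℝ) - ((α k : ℝ) + (k : ℝ)^2) ≤ C * (k+1)) :
    Tendsto
      (fun N : ℕ =>
        (((Finset.range N).filter fun n =>
            ∃ k, 2 ≤ k ∧ 2*q ≤ k^2/2 ∧
              n ∈ Finset.Icc (α k + q) (α k + k^2/2 - q) ∪
                Finset.Icc (α k + k^2/2 + q) (α k + 2*(k^2/2) - q)).card : ℝ) / N)
      atTop (nhds 1) ∧
    ∀ ε : ℝ, 0 < ε → ∃ N₀ : ℕ, ∀ N, N₀ ≤ N →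
      ((((Finset.range N).filter fun n =>
          ¬ ∃ k, 2 ≤ k ∧ 2*q ≤ k^2/2 ∧
            n ∈ Finset.Icc (α k + q) (α k + k^2/2 - q) ∪
              Finset.Icc (α k + k^2/2 + q) (α k + 2*(k^2/2) - q)).card : ℝ)) <
        (N : ℝ) * ε := by
  set P : ℕ → Prop := fun n => ∃ k, 2 ≤ k ∧ 2*q ≤ k^2/2 ∧
    n ∈ Finset.Icc (α k + q) (α k + k^2/2 - q) ∪
      Finset.Icc (α k + k^2/2 + q) (α k + 2*(k^2/2) - q)
  have hbound : ∀ ε : ℝ, 0 < ε → ∃ A : ℝ, ∀ N : ℕ,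
      (((Finset.range N).filter fun n => ¬ P n).card : ℝ) ≤ A + ε * N := by
    intro ε hε
    obtain ⟨m₀, hm₀⟩ := exists_nat_gt ((4 * q + 1 + 3 * C) / (ε / 2))
    rw [div_lt_iff₀ (by positivity)] at hm₀
    let m := m₀ + 2 * q + 1
    refine ⟨α (m + 1), fun N => ?_⟩
    rw [show ε * N = 2 * (ε / 2) * N by ring]
    refine card_filter_le_of_block_le (by positivity) m hmono hgap ?_ (by omega) N
    intro j N hj hj1 _ hN
    have hk : 2 * q ≤ (j + 1) ^ 2 / 2 := by
      rw [Nat.le_div_iff_mul_le two_pos]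
      have : 2 * q + 2 ≤ j + 1 := by omega
      nlinarith
    have hg : α (j + 1) + (j + 1) ^ 2 ≤ α (j + 2) := hgap (j + 1) (by omega)
    have hcard := card_filter_le_of_trimmed (Q := fun n => ¬ P n) (a := α (j + 1)) hN
      (by omega : α (j + 1) + 2 * ((j + 1) ^ 2 / 2) ≤ α (j + 2)) hk
      (fun n hn hmem => hn ⟨j + 1, by omega, hk, hmem⟩)
    have hlen : ((α (j + 2) - (α (j + 1) + 2 * ((j + 1) ^ 2 / 2)) + 4 * q : ℕ) : ℝ)
        ≤ α (j + 2) - (α (j + 1) + ((j + 1 : ℕ) : ℝ) ^ 2) + 1 + 4 * q := by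
      have : α (j + 2) - (α (j + 1) + 2 * ((j + 1) ^ 2 / 2)) + 4 * q
          + (α (j + 1) + (j + 1) ^ 2) ≤ α (j + 2) + 1 + 4 * q := by omega
      have hcast : ((α (j + 2) - (α (j + 1) + 2 * ((j + 1) ^ 2 / 2)) + 4 * q : ℕ) : ℝ)
          + (α (j + 1) + ((j + 1 : ℕ) : ℝ) ^ 2) ≤ α (j + 2) + 1 + 4 * q := by
        exact_mod_cast this
      linarith
    have hC' := hgap' (j + 1) (by omega)
    have hcard' : (((Finset.range N).filter fun n => ¬ P n).card : ℝ)
        ≤ ((Finset.range (α (j + 1))).filter fun n => ¬ P n).card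
          + ((α (j + 2) - (α (j + 1) + 2 * ((j + 1) ^ 2 / 2)) + 4 * q : ℕ) : ℝ) := by
      exact_mod_cast hcard
    have hj1' : (1 : ℝ) ≤ j := by exact_mod_cast hj1
    have hmj : (m₀ : ℝ) ≤ j := by exact_mod_cast (by omega : m₀ ≤ j)
    have hsmall : 4 * q + 1 + C * (j + 2) ≤ ε / 2 * (j : ℝ) ^ 2 := by
      have hD : 4 * q + 1 + 3 * C ≤ ε / 2 * j := by nlinarith
      have hDj := mul_le_mul_of_nonneg_right hD (by positivity : (0 : ℝ) ≤ j)
      have h₁ : (4 * q + 1 : ℝ) ≤ (4 * q + 1) * j := le_mul_of_one_le_right (by positivity) hj1'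
      have h₂ : C ≤ C * j := le_mul_of_one_le_right hC.le hj1'
      nlinarith
    rw [show j + 1 + 1 = j + 2 from rfl] at hC'
    have hcast : C * (((j + 1 : ℕ) : ℝ) + 1) = C * (j + 2) := by push_cast; ring
    linarith
  have hlt := eventually_card_not_lt hbound
  exact ⟨tendsto_card_div_of_card_not_lt hlt, hlt⟩
end

section
/- Let r ∈ ℕ and let β : ℝ → ℝ be a function of class C^r that is nonnegative, nondecreasing, with β(x) = 0 for x ≤ −1 and β(x) = 1 for x ≥ 0. Let a < a' be real numbers, c > 0, and set h = c·(a'−a); assume h ≤ 1 and h ≤ a'−a. Define β_{c,J} : ℝ → ℝ by β_{c,J}(x) = β((x−a)/h) + β(−(x−a')/h) − 1. Then: (i) 0 ≤ β_{c,J}(x) ≤ 1 for all x; (ii) β_{c,J}(x) = 1 for x ∈ [a, a']; (iii) β_{c,J}(x) = 0 for x ∉ [a−h, a'+h]; and (iv) for every i ≤ r, sup_{x∈ℝ} ‖iteratedFDeriv ℝ i β_{c,J} x‖ ≤ h^{−r} · max_{0 ≤ i ≤ r} sup_{x∈ℝ} ‖iteratedFDeriv ℝ i β x‖. -/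
/-- The iterated derivative of a function precomposed with an affine map. -/
theorem iteratedDeriv_comp_mul_add {i : ℕ} {f : ℝ → ℝ} (hf : ContDiff ℝ i f) (k d x : ℝ) :
    iteratedDeriv i (fun y => f (k * y + d)) x = k ^ i * iteratedDeriv i f (k * x + d) := by
  have hg : ContDiff ℝ i (fun y => f (y + d)) := hf.comp (contDiff_id.add contDiff_const)
  have e := congrFun (iteratedDeriv_comp_const_mul hg k) x
  simpa only [iteratedDeriv_comp_add_const] using e

/-- A locally constant real value gives an iterated derivative bounded by that value. -/
theorem norm_iteratedDeriv_le_of_eventuallyEq_const {f : ℝ → ℝ} {x k : ℝ}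
    (hf : f =ᶠ[nhds x] fun _ => k) (i : ℕ) : ‖iteratedDeriv i f x‖ ≤ ‖k‖ := by
  rw [hf.iteratedDeriv_eq i, iteratedDeriv_const]
  split_ifs <;> simp

/-- The derivatives of a `C^i` function that is constant on both sides of an interval are
bounded. -/
theorem bddAbove_norm_iteratedFDeriv_of_const_outside {i : ℕ} {f : ℝ → ℝ} (hf : ContDiff ℝ i f)
    {l u p q : ℝ} (hl : ∀ x ≤ l, f x = p) (hu : ∀ x, u ≤ x → f x = q) :
    BddAbove (Set.range fun x => ‖iteratedFDeriv ℝ i f x‖) := by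
  obtain ⟨C, hC⟩ := (isCompact_Icc (a := l) (b := u)).exists_bound_of_continuousOn
    (hf.continuous_iteratedDeriv i le_rfl).continuousOn
  refine ⟨max C (max ‖p‖ ‖q‖), ?_⟩
  rintro _ ⟨x, rfl⟩
  simp only [norm_iteratedFDeriv_eq_norm_iteratedDeriv]
  rcases lt_or_ge x l with hx | hx
  · refine (norm_iteratedDeriv_le_of_eventuallyEq_const (k := p) ?_ i).trans (by simp)
    filter_upwards [Iio_mem_nhds hx] with y hy using hl y (le_of_lt hy)
  · rcases lt_or_ge u x with hx' | hx'
    · refine (norm_iteratedDeriv_le_of_eventuallyEq_const (k := q) ?_ i).trans (by simp)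
      filter_upwards [Ioi_mem_nhds hx'] with y hy using hu y (le_of_lt hy)
    · exact (hC x ⟨hx, hx'⟩).trans (le_max_left _ _)

/-- **bump functions.** For a `C^r` step function `β` (nonnegative,
nondecreasing, `0` on `(-∞,-1]`, `1` on `[0,∞)`) and `h = c (a'−a) ≤ min(1, a'−a)`, the
bump function `β_{c,J}(x) = β((x−a)/h) + β(−(x−a')/h) − 1` takes values in `[0,1]`, equals
`1` on `[a,a']`, vanishes outside `[a−h, a'+h]`, and its `C^r` norm is bounded by
`h^{−r}` times the `C^r` norm of `β`. -/
theorem stmt13 (r : ℕ) (β : ℝ → ℝ)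
    (hsmooth : ContDiff ℝ (r : ℕ∞) β)
    (hnonneg : ∀ x, 0 ≤ β x) (hmono : Monotone β)
    (h0 : ∀ x : ℝ, x ≤ -1 → β x = 0) (h1 : ∀ x : ℝ, 0 ≤ x → β x = 1)
    (a a' c : ℝ) (haa' : a < a') (hc : 0 < c)
    (h : ℝ) (hh : h = c * (a' - a)) (hh1 : h ≤ 1) (hh2 : h ≤ a' - a)
    (βcJ : ℝ → ℝ)
    (hβcJ : ∀ x, βcJ x = β ((x - a) / h) + β (-(x - a') / h) - 1) :
    (∀ x, 0 ≤ βcJ x ∧ βcJ x ≤ 1) ∧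
    (∀ x ∈ Set.Icc a a', βcJ x = 1) ∧
    (∀ x, x ∉ Set.Icc (a - h) (a' + h) → βcJ x = 0) ∧
    (∀ i ≤ r, (⨆ x : ℝ, ‖iteratedFDeriv ℝ i βcJ x‖) ≤
      (h ^ r)⁻¹ * ⨆ j : Fin (r + 1), ⨆ x : ℝ, ‖iteratedFDeriv ℝ (j : ℕ) β x‖) := by
  have hpos : 0 < h := hh ▸ mul_pos hc (sub_pos.2 haa')
  have hle : ∀ x, β x ≤ 1 := fun x =>
    (hmono (le_max_left x 0)).trans (h1 _ (le_max_right x 0)).le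
  have hleft : ∀ x ≤ a', βcJ x = β ((x - a) / h) := fun x hx => by
    rw [hβcJ, h1 (-(x - a') / h) (div_nonneg (by linarith) hpos.le)]
    ring
  have hright : ∀ x, a ≤ x → βcJ x = β (-(x - a') / h) := fun x hx => by
    rw [hβcJ, h1 ((x - a) / h) (div_nonneg (by linarith) hpos.le)]
    ring
  refine ⟨fun x => ?_, fun x hx => ?_, fun x hx => ?_, fun i hi => ?_⟩
  · rcases le_total x a' with hx | hx
    · rw [hleft x hx]
      exact ⟨hnonneg _, hle _⟩
    · rw [hright x (haa'.le.trans hx)]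
      exact ⟨hnonneg _, hle _⟩
  · rw [hleft x hx.2]
    exact h1 _ (div_nonneg (by linarith [hx.1]) hpos.le)
  · rcases lt_or_ge x (a - h) with hx' | hx'
    · rw [hleft x (by linarith)]
      exact h0 _ ((div_le_iff₀ hpos).2 (by linarith))
    · have hx'' : a' + h < x := not_le.1 fun H => hx ⟨hx', H⟩
      rw [hright x (by linarith)]
      exact h0 _ ((div_le_iff₀ hpos).2 (by linarith))
  · have hsm : ContDiff ℝ i β := hsmooth.of_le (by exact_mod_cast hi)
    have hbdd := bddAbove_norm_iteratedFDeriv_of_const_outside hsm h0 h1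
    have hsup : ∀ y, ‖iteratedDeriv i β y‖ ≤
        ⨆ j : Fin (r + 1), ⨆ x : ℝ, ‖iteratedFDeriv ℝ (j : ℕ) β x‖ := fun y => by
      rw [← norm_iteratedFDeriv_eq_norm_iteratedDeriv]
      exact (le_ciSup hbdd y).trans <|
        le_ciSup (f := fun j : Fin (r + 1) => ⨆ x : ℝ, ‖iteratedFDeriv ℝ (j : ℕ) β x‖)
          (Set.finite_range _).bddAbove ⟨i, Nat.lt_succ_of_le hi⟩
    have key : ∀ k d x : ℝ, |k| = h⁻¹ → βcJ =ᶠ[nhds x] (fun y => β (k * y + d)) →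
        ‖iteratedFDeriv ℝ i βcJ x‖ ≤
          (h ^ r)⁻¹ * ⨆ j : Fin (r + 1), ⨆ x : ℝ, ‖iteratedFDeriv ℝ (j : ℕ) β x‖ := by
      intro k d x hk he
      rw [norm_iteratedFDeriv_eq_norm_iteratedDeriv, he.iteratedDeriv_eq i,
        iteratedDeriv_comp_mul_add hsm, norm_mul, norm_pow, Real.norm_eq_abs, hk, inv_pow]
      exact mul_le_mul (inv_anti₀ (pow_pos hpos r) (pow_le_pow_of_le_one hpos.le hh1 hi))
        (hsup _) (norm_nonneg _) (by positivity)
    refine ciSup_le fun x => ?_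
    rcases lt_or_ge x a' with hx | hx
    · refine key h⁻¹ (-a / h) x (abs_of_pos (inv_pos.2 hpos)) ?_
      filter_upwards [Iio_mem_nhds hx] with y hy
      rw [hleft y (le_of_lt hy)]
      congr 1
      ring
    · refine key (-h⁻¹) (a' / h) x (by rw [abs_neg, abs_of_pos (inv_pos.2 hpos)]) ?_
      filter_upwards [Ioi_mem_nhds (haa'.trans_le hx)] with y hy
      rw [hright y (le_of_lt hy)]
      congr 1
      ring
end

section
/- Let E be a finite-dimensional normed real vector space, r ∈ ℕ with r ≥ 1, C > 0 and μ ∈ (0,1). Let (h_k)_{k≥1} be a sequence of maps h_k : E → E, each of class C^r, such that for every k ≥ 1, every i ≤ r and every x ∈ E, ‖iteratedFDeriv ℝ i h_k x‖ ≤ C·μ^k. Then: (a) for every n ≥ 1 the series Σ_{k≥n} h_k(x) converges for every x, and the map ψ_n : E → E, ψ_n(x) = x + Σ_{k=n}^{∞} h_k(x), is of class C^r; (b) sup_{x∈E} ‖ψ_n(x) − x‖ → 0 as n → ∞; (c) there exists n₀ such that for every n ≥ n₀ the map ψ_n is a bijection of E whose inverse is also of class C^r. -/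
open Filter

/-- A perturbation `x ↦ x + g x` of the identity by a `C^n` map whose derivative has norm at most
`c < 1` is a `C^n` diffeomorphism. -/
theorem ContDiff.exists_contDiff_inverse_add_of_norm_fderiv_le
    {E : Type*} [NormedAddCommGroup E] [NormedSpace ℝ E] [CompleteSpace E]
    {n : WithTop ℕ∞} {g : E → E} {c : NNReal} (hg : ContDiff ℝ n g) (hn : n ≠ 0)
    (hc : c < 1) (hgc : ∀ x, ‖fderiv ℝ g x‖ ≤ c) :
    ∃ φ : E → E, ContDiff ℝ n φ ∧ (∀ x, φ (x + g x) = x) ∧ (∀ x, φ x + g (φ x) = x) := by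
  have hdiff : Differentiable ℝ g := hg.differentiable hn
  have hlip : LipschitzWith c g := lipschitzWith_of_nnnorm_fderiv_le hdiff hgc
  have happrox : ApproximatesLinearOn (fun x => x + g x)
      (ContinuousLinearEquiv.refl ℝ E : E →L[ℝ] E) Set.univ c := by
    apply LipschitzOnWith.approximatesLinearOn
    rw [lipschitzOnWith_univ]
    convert! hlip
    ext x
    simp
  have hsmall : Subsingleton E ∨
      c < ‖((ContinuousLinearEquiv.refl ℝ E).symm : E →L[ℝ] E)‖₊⁻¹ := by
    rcases subsingleton_or_nontrivial E with hE | hE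
    · exact .inl hE
    · right
      have : ‖((ContinuousLinearEquiv.refl ℝ E).symm : E →L[ℝ] E)‖₊ = 1 :=
        NNReal.eq ContinuousLinearMap.norm_id
      rwa [this, inv_one]
  let e : E ≃ₜ E := happrox.toHomeomorph _ hsmall
  have hlt (x : E) : ‖-fderiv ℝ g x‖ < 1 := by
    rw [norm_neg]
    exact (hgc x).trans_lt (mod_cast hc)
  have hderiv (x : E) : HasFDerivAt e
      (ContinuousLinearEquiv.ofUnit (Units.oneSub _ (hlt x)) : E →L[ℝ] E) x := by
    have hsum := (hasFDerivAt_id x).add (hdiff x).hasFDerivAt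
    convert! hsum using 1
    ext v
    change ((1 : E →L[ℝ] E) - -fderiv ℝ g x) v = _
    simp
  exact ⟨e.symm, e.contDiff_symm hderiv (contDiff_id.add hg), e.symm_apply_apply,
    e.apply_symm_apply⟩

/-- **Lemma `l_psi_n`, abstract form.** If the maps `h k : E → E` are
`C^r` with all derivatives up to order `r` bounded by `C μ^k` (`0 < μ < 1`), then the
maps `ψ n = id + Σ_{k ≥ n} h k` are well defined and `C^r`, converge uniformly to the
identity as `n → ∞`, and are `C^r` diffeomorphisms of `E` for all large `n`. -/
theorem stmt14
    {E : Type*} [NormedAddCommGroup E] [NormedSpace ℝ E] [FiniteDimensional ℝ E]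
    (r : ℕ) (hr : 1 ≤ r) (C μ : ℝ) (hC : 0 < C) (hμ0 : 0 < μ) (hμ1 : μ < 1)
    (h : ℕ → E → E)
    (hsmooth : ∀ k : ℕ, 1 ≤ k → ContDiff ℝ (r : ℕ∞) (h k))
    (hbound : ∀ k : ℕ, 1 ≤ k → ∀ i ≤ r, ∀ x : E,
      ‖iteratedFDeriv ℝ i (h k) x‖ ≤ C * μ ^ k) :
    (∀ n : ℕ, 1 ≤ n →
      (∀ x : E, Summable fun k : ℕ => h (n + k) x) ∧
      ContDiff ℝ (r : ℕ∞) (fun x : E => x + ∑' k : ℕ, h (n + k) x)) ∧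
    Tendsto (fun n : ℕ => ⨆ x : E, ‖∑' k : ℕ, h (n + k) x‖) atTop (nhds 0) ∧
    (∃ n₀ : ℕ, ∀ n, n₀ ≤ n → ∃ φ : E → E, ContDiff ℝ (r : ℕ∞) φ ∧
      (∀ x : E, φ (x + ∑' k : ℕ, h (n + k) x) = x) ∧
      (∀ x : E, φ x + ∑' k : ℕ, h (n + k) (φ x) = x)) := by
  have hsum (n : ℕ) : HasSum (fun k => C * μ ^ (n + k)) (C * μ ^ n * (1 - μ)⁻¹) := by
    simpa only [pow_add, mul_assoc] using
      (hasSum_geometric_of_lt_one hμ0.le hμ1).mul_left (C * μ ^ n)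
  have htail : Tendsto (fun n : ℕ => C * μ ^ n * (1 - μ)⁻¹) atTop (nhds 0) := by
    simpa using ((tendsto_pow_atTop_nhds_zero_of_lt_one hμ0.le hμ1).const_mul C).mul_const
      (1 - μ)⁻¹
  have hterm {n : ℕ} (hn : 1 ≤ n) (k : ℕ) (x : E) : ‖h (n + k) x‖ ≤ C * μ ^ (n + k) := by
    simpa using hbound (n + k) (by omega) 0 (Nat.zero_le r) x
  have hsm {n : ℕ} (hn : 1 ≤ n) (k : ℕ) : ContDiff ℝ (r : ℕ∞) (h (n + k)) :=
    hsmooth _ (by omega)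
  have hbd {n : ℕ} (hn : 1 ≤ n) (i k : ℕ) (x : E) (hi : (i : ℕ∞) ≤ (r : ℕ∞)) :
      ‖iteratedFDeriv ℝ i (h (n + k)) x‖ ≤ C * μ ^ (n + k) :=
    hbound _ (by omega) i (mod_cast hi) x
  have hcont {n : ℕ} (hn : 1 ≤ n) :
      ContDiff ℝ (r : ℕ∞) (fun x => ∑' k : ℕ, h (n + k) x) :=
    contDiff_tsum (hsm hn) (fun _ _ => (hsum n).summable) (hbd hn)
  refine ⟨fun n hn => ⟨fun x => .of_norm_bounded (hsum n).summable (hterm hn · x),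
    contDiff_id.add (hcont hn)⟩, ?_, ?_⟩
  · refine squeeze_zero' (.of_forall fun n => Real.iSup_nonneg fun x => norm_nonneg _) ?_ htail
    filter_upwards [eventually_ge_atTop 1] with n hn
    exact ciSup_le fun x => tsum_of_norm_bounded (hsum n) (hterm hn · x)
  · obtain ⟨n₀, hn₀⟩ := eventually_atTop.1
      ((htail.eventually_lt_const one_pos).and (eventually_ge_atTop 1))
    refine ⟨n₀, fun n hnn => ?_⟩
    obtain ⟨hlt, hn⟩ := hn₀ n hnn
    have hnonneg : 0 ≤ C * μ ^ n * (1 - μ)⁻¹ :=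
      (hsum n).nonneg fun k => by positivity
    have : CompleteSpace E := FiniteDimensional.complete ℝ E
    refine (hcont hn).exists_contDiff_inverse_add_of_norm_fderiv_le
      (c := ⟨_, hnonneg⟩) (mod_cast (by omega : r ≠ 0)) hlt fun x => ?_
    have hone : ((1 : ℕ) : ℕ∞) ≤ (r : ℕ∞) := mod_cast hr
    rw [← norm_iteratedFDeriv_one, iteratedFDeriv_tsum_apply (hsm hn)
      (fun _ _ => (hsum n).summable) (hbd hn) hone]
    exact tsum_of_norm_bounded (hsum n) fun k => hbd hn 1 k x hone
end
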